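/- arXiv:2508.09405 — 5 statements merged into one kernel-verified Lean document; each statement's English description precedes it below -/
import Mathlib

section
/- Let k be a field. Every indecomposable finite-dimensional representation of the Rudakov quiver Q_Rud over k, other than the two representations M and M', satisfies either e = f = 0 or e' = f' = 0. -/
open scoped Classical
set_option maxHeartbeats 1000000

noncomputable section

/-- A finite-dimensional representation of the Rudakov quiver `Q_Rud` over a field `k`:
two finite-dimensional vector spaces `V₁`, `V₂`, maps `e f : V₁ → V₂` and
`e' f' : V₂ → V₁` satisfying `ee' = e'e = ff' = f'f = 0`, `ef' = -fe'`, `e'f = -f'e`. -/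
structure RudRep (k : Type) [Field k] : Type 1 where
  V₁ : Type
  V₂ : Type
  [acg₁ : AddCommGroup V₁]
  [acg₂ : AddCommGroup V₂]
  [mod₁ : Module k V₁]
  [mod₂ : Module k V₂]
  [fd₁ : FiniteDimensional k V₁]
  [fd₂ : FiniteDimensional k V₂]
  e : V₁ →ₗ[k] V₂
  f : V₁ →ₗ[k] V₂
  e' : V₂ →ₗ[k] V₁
  f' : V₂ →ₗ[k] V₁
  rel_ee' : e ∘ₗ e' = 0
  rel_e'e : e' ∘ₗ e = 0
  rel_ff' : f ∘ₗ f' = 0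
  rel_f'f : f' ∘ₗ f = 0
  rel_ef' : e ∘ₗ f' = -(f ∘ₗ e')
  rel_e'f : e' ∘ₗ f = -(f' ∘ₗ e)

attribute [instance] RudRep.acg₁ RudRep.acg₂ RudRep.mod₁ RudRep.mod₂ RudRep.fd₁ RudRep.fd₂

variable {k : Type} [Field k]

namespace RudRep

lemma ee'_apply (X : RudRep k) (y : X.V₂) : X.e (X.e' y) = 0 := by
  simpa using DFunLike.congr_fun X.rel_ee' y
lemma e'e_apply (X : RudRep k) (x : X.V₁) : X.e' (X.e x) = 0 := by
  simpa using DFunLike.congr_fun X.rel_e'e x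
lemma ff'_apply (X : RudRep k) (y : X.V₂) : X.f (X.f' y) = 0 := by
  simpa using DFunLike.congr_fun X.rel_ff' y
lemma f'f_apply (X : RudRep k) (x : X.V₁) : X.f' (X.f x) = 0 := by
  simpa using DFunLike.congr_fun X.rel_f'f x
lemma ef'_apply (X : RudRep k) (y : X.V₂) : X.e (X.f' y) = -(X.f (X.e' y)) := by
  simpa using DFunLike.congr_fun X.rel_ef' y
lemma e'f_apply (X : RudRep k) (x : X.V₁) : X.e' (X.f x) = -(X.f' (X.e x)) := by
  simpa using DFunLike.congr_fun X.rel_e'f x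

/-- The involution `σ` swapping the two vertices and interchanging `e ↔ e'`, `f ↔ f'`. -/
def sigma (X : RudRep k) : RudRep k where
  V₁ := X.V₂
  V₂ := X.V₁
  e := X.e'
  f := X.f'
  e' := X.e
  f' := X.f
  rel_ee' := X.rel_e'e
  rel_e'e := X.rel_ee'
  rel_ff' := X.rel_f'f
  rel_f'f := X.rel_ff'
  rel_ef' := X.rel_e'f
  rel_e'f := X.rel_ef'

/-- A representation is zero iff both underlying spaces are trivial. -/
def IsZero (X : RudRep k) : Prop := Subsingleton X.V₁ ∧ Subsingleton X.V₂

/-- Direct sum of two representations of the Rudakov quiver. -/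
def dsum (X Y : RudRep k) : RudRep k where
  V₁ := X.V₁ × Y.V₁
  V₂ := X.V₂ × Y.V₂
  e := X.e.prodMap Y.e
  f := X.f.prodMap Y.f
  e' := X.e'.prodMap Y.e'
  f' := X.f'.prodMap Y.f'
  rel_ee' := by
    apply LinearMap.ext; rintro ⟨a, b⟩
    simp [Prod.ext_iff, ee'_apply]
  rel_e'e := by
    apply LinearMap.ext; rintro ⟨a, b⟩
    simp [Prod.ext_iff, e'e_apply]
  rel_ff' := by
    apply LinearMap.ext; rintro ⟨a, b⟩
    simp [Prod.ext_iff, ff'_apply]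
  rel_f'f := by
    apply LinearMap.ext; rintro ⟨a, b⟩
    simp [Prod.ext_iff, f'f_apply]
  rel_ef' := by
    apply LinearMap.ext; rintro ⟨a, b⟩
    simp [Prod.ext_iff, ef'_apply]
  rel_e'f := by
    apply LinearMap.ext; rintro ⟨a, b⟩
    simp [Prod.ext_iff, e'f_apply]

/-- The zero representation. -/
def zeroRep (k : Type) [Field k] : RudRep k where
  V₁ := Fin 0 → k
  V₂ := Fin 0 → k
  e := 0
  f := 0
  e' := 0
  f' := 0
  rel_ee' := by simp
  rel_e'e := by simp
  rel_ff' := by simp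
  rel_f'f := by simp
  rel_ef' := by simp
  rel_e'f := by simp

/-- `n`-fold direct sum `X^{⊕ n}`. -/
def npow (X : RudRep k) : ℕ → RudRep k
  | 0 => zeroRep k
  | n + 1 => (npow X n).dsum X

end RudRep

/-- Morphisms of representations of `Q_Rud`, as a submodule of the product of Hom spaces:
pairs of linear maps commuting with `e, f, e', f'`. -/
def RudHomS (X Y : RudRep k) :
    Submodule k ((X.V₁ →ₗ[k] Y.V₁) × (X.V₂ →ₗ[k] Y.V₂)) where
  carrier := {p | Y.e ∘ₗ p.1 = p.2 ∘ₗ X.e ∧ Y.f ∘ₗ p.1 = p.2 ∘ₗ X.f ∧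
      Y.e' ∘ₗ p.2 = p.1 ∘ₗ X.e' ∧ Y.f' ∘ₗ p.2 = p.1 ∘ₗ X.f'}
  add_mem' := by
    intro a b ha hb
    obtain ⟨ha1, ha2, ha3, ha4⟩ := ha
    obtain ⟨hb1, hb2, hb3, hb4⟩ := hb
    refine ⟨?_, ?_, ?_, ?_⟩ <;>
      simp only [Prod.fst_add, Prod.snd_add, LinearMap.add_comp, LinearMap.comp_add,
        ha1, ha2, ha3, ha4, hb1, hb2, hb3, hb4]
  zero_mem' := by
    refine ⟨?_, ?_, ?_, ?_⟩ <;> simp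
  smul_mem' := by
    intro c a ha
    obtain ⟨h1, h2, h3, h4⟩ := ha
    refine ⟨?_, ?_, ?_, ?_⟩ <;>
      simp only [Prod.smul_fst, Prod.smul_snd, LinearMap.smul_comp, LinearMap.comp_smul,
        h1, h2, h3, h4]

/-- The space of morphisms of representations `X → Y`. -/
abbrev RudHom (X Y : RudRep k) : Type := ↥(RudHomS X Y)

private lemma square_comp
    {A₁ A₂ B₁ B₂ C₁ C₂ : Type}
    [AddCommGroup A₁] [AddCommGroup A₂] [AddCommGroup B₁] [AddCommGroup B₂]
    [AddCommGroup C₁] [AddCommGroup C₂]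
    [Module k A₁] [Module k A₂] [Module k B₁] [Module k B₂] [Module k C₁] [Module k C₂]
    (u : A₁ →ₗ[k] A₂) (v : B₁ →ₗ[k] B₂) (w : C₁ →ₗ[k] C₂)
    (h₁ : A₁ →ₗ[k] B₁) (h₂ : A₂ →ₗ[k] B₂) (g₁ : B₁ →ₗ[k] C₁) (g₂ : B₂ →ₗ[k] C₂)
    (hh : v ∘ₗ h₁ = h₂ ∘ₗ u) (hg : w ∘ₗ g₁ = g₂ ∘ₗ v) :
    w ∘ₗ (g₁ ∘ₗ h₁) = (g₂ ∘ₗ h₂) ∘ₗ u := by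
  apply LinearMap.ext
  intro x
  have e1 := DFunLike.congr_fun hh x
  have e2 := DFunLike.congr_fun hg (h₁ x)
  simp only [LinearMap.comp_apply] at e1 e2 ⊢
  rw [e2, e1]

/-- Composition of morphisms of representations. -/
def RudHom.comp {X Y Z : RudRep k} (g : RudHom Y Z) (h : RudHom X Y) : RudHom X Z := by
  refine ⟨(g.1.1 ∘ₗ h.1.1, g.1.2 ∘ₗ h.1.2), ?_⟩
  obtain ⟨hg1, hg2, hg3, hg4⟩ := g.2
  obtain ⟨hh1, hh2, hh3, hh4⟩ := h.2
  exact ⟨square_comp X.e Y.e Z.e h.1.1 h.1.2 g.1.1 g.1.2 hh1 hg1,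
    square_comp X.f Y.f Z.f h.1.1 h.1.2 g.1.1 g.1.2 hh2 hg2,
    square_comp X.e' Y.e' Z.e' h.1.2 h.1.1 g.1.2 g.1.1 hh3 hg3,
    square_comp X.f' Y.f' Z.f' h.1.2 h.1.1 g.1.2 g.1.1 hh4 hg4⟩

/-- The identity morphism. -/
def RudHom.idHom (X : RudRep k) : RudHom X X :=
  ⟨(LinearMap.id, LinearMap.id), by refine ⟨?_, ?_, ?_, ?_⟩ <;> simp⟩

/-- Two representations are isomorphic iff there is a morphism between them whose
components are bijective. -/
def RudIso (X Y : RudRep k) : Prop :=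
  ∃ g : RudHom X Y, Function.Bijective g.1.1 ∧ Function.Bijective g.1.2

/-- A representation is indecomposable if it is nonzero and any decomposition as a direct
sum has a trivial summand. -/
def RudRep.Indec (X : RudRep k) : Prop :=
  ¬ X.IsZero ∧ ∀ Y Z : RudRep k, RudIso X (Y.dsum Z) → Y.IsZero ∨ Z.IsZero

namespace RudRep

/-- Build a representation of `Q_Rud` from a representation of the Kronecker quiver,
extending by zero (`e' = f' = 0`). -/
def ofKron {V W : Type} [AddCommGroup V] [AddCommGroup W] [Module k V] [Module k W]
    [FiniteDimensional k V] [FiniteDimensional k W] (e f : V →ₗ[k] W) : RudRep k where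
  V₁ := V
  V₂ := W
  e := e
  f := f
  e' := 0
  f' := 0
  rel_ee' := by simp
  rel_e'e := by simp
  rel_ff' := by simp
  rel_f'f := by simp
  rel_ef' := by simp
  rel_e'f := by simp

/-- Build a representation of `Q_Rud` from four matrices satisfying the relations. -/
def ofMatrices {m n : ℕ} (E F : Matrix (Fin n) (Fin m) k) (E' F' : Matrix (Fin m) (Fin n) k)
    (h1 : E * E' = 0) (h2 : E' * E = 0) (h3 : F * F' = 0) (h4 : F' * F = 0)
    (h5 : E * F' = -(F * E')) (h6 : E' * F = -(F' * E)) : RudRep k where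
  V₁ := Fin m → k
  V₂ := Fin n → k
  e := Matrix.toLin' E
  f := Matrix.toLin' F
  e' := Matrix.toLin' E'
  f' := Matrix.toLin' F'
  rel_ee' := by rw [← Matrix.toLin'_mul, h1]; simp
  rel_e'e := by rw [← Matrix.toLin'_mul, h2]; simp
  rel_ff' := by rw [← Matrix.toLin'_mul, h3]; simp
  rel_f'f := by rw [← Matrix.toLin'_mul, h4]; simp
  rel_ef' := by rw [← Matrix.toLin'_mul, ← Matrix.toLin'_mul, h5]; simp
  rel_e'f := by rw [← Matrix.toLin'_mul, ← Matrix.toLin'_mul, h6]; simp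

end RudRep

/-- The projective-injective representation `M`, with `e x₁ = y₁`, `f x₁ = y₂`,
`e' y₂ = x₂`, `f' y₁ = -x₂` on bases `x₁, x₂` of `M₁` and `y₁, y₂` of `M₂`. -/
def repM (k : Type) [Field k] : RudRep k :=
  RudRep.ofMatrices (k := k)
    !![(1 : k), 0; 0, 0] !![(0 : k), 0; 1, 0] !![(0 : k), 0; 0, 1] !![(0 : k), 0; -1, 0]
    (by ext i j; fin_cases i <;> fin_cases j <;>
      simp [Matrix.mul_apply, Fin.sum_univ_two])
    (by ext i j; fin_cases i <;> fin_cases j <;>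
      simp [Matrix.mul_apply, Fin.sum_univ_two])
    (by ext i j; fin_cases i <;> fin_cases j <;>
      simp [Matrix.mul_apply, Fin.sum_univ_two])
    (by ext i j; fin_cases i <;> fin_cases j <;>
      simp [Matrix.mul_apply, Fin.sum_univ_two])
    (by ext i j; fin_cases i <;> fin_cases j <;>
      simp [Matrix.mul_apply, Fin.sum_univ_two])
    (by ext i j; fin_cases i <;> fin_cases j <;>
      simp [Matrix.mul_apply, Fin.sum_univ_two])

/-- The projective-injective representation `M' = σ(M)`. -/
def repM' (k : Type) [Field k] : RudRep k := (repM k).sigma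

namespace RudRep

/-- The subrepresentation on a pair of subspaces stable under all four maps. -/
def sub (X : RudRep k) (A₁ : Submodule k X.V₁) (A₂ : Submodule k X.V₂)
    (he : ∀ v ∈ A₁, X.e v ∈ A₂) (hf : ∀ v ∈ A₁, X.f v ∈ A₂)
    (he' : ∀ u ∈ A₂, X.e' u ∈ A₁) (hf' : ∀ u ∈ A₂, X.f' u ∈ A₁) : RudRep k where
  V₁ := A₁
  V₂ := A₂
  e := X.e.restrict he
  f := X.f.restrict hf
  e' := X.e'.restrict he'
  f' := X.f'.restrict hf'
  rel_ee' := by ext u; simp [ee'_apply]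
  rel_e'e := by ext v; simp [e'e_apply]
  rel_ff' := by ext u; simp [ff'_apply]
  rel_f'f := by ext v; simp [f'f_apply]
  rel_ef' := by ext u; simp [ef'_apply]
  rel_e'f := by ext v; simp [e'f_apply]

end RudRep

/-- Linear equivalences `Y → X` intertwining all four maps give an isomorphism `X ≅ Y`. -/
lemma RudIso.of_linearEquiv {X Y : RudRep k} (a : Y.V₁ ≃ₗ[k] X.V₁) (b : Y.V₂ ≃ₗ[k] X.V₂)
    (he : ∀ v, b (Y.e v) = X.e (a v)) (hf : ∀ v, b (Y.f v) = X.f (a v))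
    (he' : ∀ u, a (Y.e' u) = X.e' (b u)) (hf' : ∀ u, a (Y.f' u) = X.f' (b u)) :
    RudIso X Y := by
  refine ⟨⟨(a.symm.toLinearMap, b.symm.toLinearMap), ?_, ?_, ?_, ?_⟩,
    a.symm.bijective, b.symm.bijective⟩ <;> ext v
  · exact b.injective (by simp [he])
  · exact b.injective (by simp [hf])
  · exact a.injective (by simp [he'])
  · exact a.injective (by simp [hf'])

/-- In an indecomposable representation, one of two complementary subrepresentations is zero. -/
lemma RudRep.Indec.eq_bot_or_eq_bot {X : RudRep k} (hX : X.Indec)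
    {A₁ B₁ : Submodule k X.V₁} {A₂ B₂ : Submodule k X.V₂}
    (h₁ : IsCompl A₁ B₁) (h₂ : IsCompl A₂ B₂)
    (hAe : ∀ v ∈ A₁, X.e v ∈ A₂) (hAf : ∀ v ∈ A₁, X.f v ∈ A₂)
    (hAe' : ∀ u ∈ A₂, X.e' u ∈ A₁) (hAf' : ∀ u ∈ A₂, X.f' u ∈ A₁)
    (hBe : ∀ v ∈ B₁, X.e v ∈ B₂) (hBf : ∀ v ∈ B₁, X.f v ∈ B₂)
    (hBe' : ∀ u ∈ B₂, X.e' u ∈ B₁) (hBf' : ∀ u ∈ B₂, X.f' u ∈ B₁) :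
    (A₁ = ⊥ ∧ A₂ = ⊥) ∨ (B₁ = ⊥ ∧ B₂ = ⊥) := by
  have hiso : RudIso X ((X.sub A₁ A₂ hAe hAf hAe' hAf').dsum (X.sub B₁ B₂ hBe hBf hBe' hBf')) := by
    refine RudIso.of_linearEquiv (Submodule.prodEquivOfIsCompl A₁ B₁ h₁)
      (Submodule.prodEquivOfIsCompl A₂ B₂ h₂) ?_ ?_ ?_ ?_
    · exact fun p : A₁ × B₁ => (map_add X.e (p.1 : X.V₁) (p.2 : X.V₁)).symm
    · exact fun p : A₁ × B₁ => (map_add X.f (p.1 : X.V₁) (p.2 : X.V₁)).symm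
    · exact fun p : A₂ × B₂ => (map_add X.e' (p.1 : X.V₂) (p.2 : X.V₂)).symm
    · exact fun p : A₂ × B₂ => (map_add X.f' (p.1 : X.V₂) (p.2 : X.V₂)).symm
  exact (hX.2 _ _ hiso).imp
    (fun h => ⟨Submodule.subsingleton_iff_eq_bot.1 h.1, Submodule.subsingleton_iff_eq_bot.1 h.2⟩)
    (fun h => ⟨Submodule.subsingleton_iff_eq_bot.1 h.1, Submodule.subsingleton_iff_eq_bot.1 h.2⟩)

/-- The range of a section and the kernel of the corresponding retraction are complementary. -/
lemma isCompl_range_ker_of_leftInverse {V W : Type} [AddCommGroup V] [AddCommGroup W]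
    [Module k V] [Module k W] (i : W →ₗ[k] V) (r : V →ₗ[k] W) (h : ∀ w, r (i w) = w) :
    IsCompl (LinearMap.range i) (LinearMap.ker r) := by
  constructor
  · rw [Submodule.disjoint_def]
    rintro _ ⟨w, rfl⟩ hw
    rw [LinearMap.mem_ker, h] at hw
    simp [hw]
  · rw [codisjoint_iff, eq_top_iff]
    intro v _
    refine Submodule.mem_sup.2 ⟨i (r v), ⟨_, rfl⟩, v - i (r v), ?_, by abel⟩
    simp [h]

/-- A nonzero retract of an indecomposable representation is isomorphic to it. -/
lemma RudRep.Indec.iso_of_retract {X Y : RudRep k} (hX : X.Indec) (hY : ¬ Y.IsZero)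
    (i : RudHom Y X) (r : RudHom X Y) (h₁ : ∀ v, r.1.1 (i.1.1 v) = v)
    (h₂ : ∀ u, r.1.2 (i.1.2 u) = u) : RudIso X Y := by
  obtain ⟨⟨i₁, i₂⟩, iE, iF, iE', iF'⟩ := i
  obtain ⟨⟨r₁, r₂⟩, re, rf, re', rf'⟩ := r
  simp only [LinearMap.ext_iff, LinearMap.comp_apply] at iE iF iE' iF'
  have re₀ := re
  have rf₀ := rf
  have re₀' := re'
  have rf₀' := rf'
  simp only [LinearMap.ext_iff, LinearMap.comp_apply] at re₀ rf₀ re₀' rf₀' h₁ h₂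
  rcases hX.eq_bot_or_eq_bot (isCompl_range_ker_of_leftInverse i₁ r₁ h₁)
    (isCompl_range_ker_of_leftInverse i₂ r₂ h₂)
    (by rintro _ ⟨v, rfl⟩; exact ⟨_, (iE v).symm⟩)
    (by rintro _ ⟨v, rfl⟩; exact ⟨_, (iF v).symm⟩)
    (by rintro _ ⟨v, rfl⟩; exact ⟨_, (iE' v).symm⟩)
    (by rintro _ ⟨v, rfl⟩; exact ⟨_, (iF' v).symm⟩)
    (by intro v hv; rw [LinearMap.mem_ker] at hv ⊢; rw [← re₀, hv, map_zero])
    (by intro v hv; rw [LinearMap.mem_ker] at hv ⊢; rw [← rf₀, hv, map_zero])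
    (by intro v hv; rw [LinearMap.mem_ker] at hv ⊢; rw [← re₀', hv, map_zero])
    (by intro v hv; rw [LinearMap.mem_ker] at hv ⊢; rw [← rf₀', hv, map_zero]) with h | h
  · refine absurd ⟨⟨fun a b => ?_⟩, ⟨fun a b => ?_⟩⟩ hY
    · rw [← h₁ a, ← h₁ b, LinearMap.range_eq_bot.1 h.1]; rfl
    · rw [← h₂ a, ← h₂ b, LinearMap.range_eq_bot.1 h.2]; rfl
  · exact ⟨⟨(r₁, r₂), re, rf, re', rf'⟩,
      ⟨LinearMap.ker_eq_bot.1 h.1, fun v => ⟨_, h₁ v⟩⟩,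
      ⟨LinearMap.ker_eq_bot.1 h.2, fun v => ⟨_, h₂ v⟩⟩⟩

section Retract

open RudRep

variable (X : RudRep k) (x : X.V₁) (φ : X.V₁ →ₗ[k] k)

/-- The morphism `M → X` sending `x₁` to `x`. -/
def RudHom.fromM : RudHom (repM k) X := by
  refine ⟨(Fintype.linearCombination k ![x, X.e' (X.f x)],
    Fintype.linearCombination k ![X.e x, X.f x]), ?_, ?_, ?_, ?_⟩ <;>
    refine LinearMap.ext fun v : Fin 2 → k => ?_
  · change X.e (Fintype.linearCombination k ![x, X.e' (X.f x)] v) =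
      Fintype.linearCombination k ![X.e x, X.f x] (Matrix.toLin' !![(1 : k), 0; 0, 0] v)
    simp [Fintype.linearCombination_apply, ee'_apply, Matrix.vecHead, Matrix.vecTail]
  · change X.f (Fintype.linearCombination k ![x, X.e' (X.f x)] v) =
      Fintype.linearCombination k ![X.e x, X.f x] (Matrix.toLin' !![(0 : k), 0; 1, 0] v)
    simp [Fintype.linearCombination_apply, ff'_apply, e'f_apply, Matrix.vecHead, Matrix.vecTail]
  · change X.e' (Fintype.linearCombination k ![X.e x, X.f x] v) =
      Fintype.linearCombination k ![x, X.e' (X.f x)] (Matrix.toLin' !![(0 : k), 0; 0, 1] v)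
    simp [Fintype.linearCombination_apply, e'e_apply, Matrix.vecHead, Matrix.vecTail]
  · change X.f' (Fintype.linearCombination k ![X.e x, X.f x] v) =
      Fintype.linearCombination k ![x, X.e' (X.f x)] (Matrix.toLin' !![(0 : k), 0; -1, 0] v)
    simp [Fintype.linearCombination_apply, f'f_apply, e'f_apply, Matrix.vecHead, Matrix.vecTail]

/-- The morphism `X → M` whose `x₂`-coordinate is `φ`. -/
def RudHom.toM : RudHom X (repM k) := by
  refine ⟨(LinearMap.pi ![φ ∘ₗ X.e' ∘ₗ X.f, φ], LinearMap.pi ![-(φ ∘ₗ X.f'), φ ∘ₗ X.e']),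
    ?_, ?_, ?_, ?_⟩ <;> refine LinearMap.ext fun v => ?_
  · change Matrix.toLin' !![(1 : k), 0; 0, 0] (LinearMap.pi ![φ ∘ₗ X.e' ∘ₗ X.f, φ] v) =
      LinearMap.pi ![-(φ ∘ₗ X.f'), φ ∘ₗ X.e'] (X.e v)
    ext j; fin_cases j <;> simp [e'e_apply, e'f_apply, Matrix.vecHead, Matrix.vecTail]
  · change Matrix.toLin' !![(0 : k), 0; 1, 0] (LinearMap.pi ![φ ∘ₗ X.e' ∘ₗ X.f, φ] v) =
      LinearMap.pi ![-(φ ∘ₗ X.f'), φ ∘ₗ X.e'] (X.f v)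
    ext j; fin_cases j <;> simp [f'f_apply, Matrix.vecHead, Matrix.vecTail]
  · change Matrix.toLin' !![(0 : k), 0; 0, 1] (LinearMap.pi ![-(φ ∘ₗ X.f'), φ ∘ₗ X.e'] v) =
      LinearMap.pi ![φ ∘ₗ X.e' ∘ₗ X.f, φ] (X.e' v)
    ext j; fin_cases j <;> simp [ee'_apply, e'f_apply, Matrix.vecHead, Matrix.vecTail]
  · change Matrix.toLin' !![(0 : k), 0; -1, 0] (LinearMap.pi ![-(φ ∘ₗ X.f'), φ ∘ₗ X.e'] v) =
      LinearMap.pi ![φ ∘ₗ X.e' ∘ₗ X.f, φ] (X.f' v)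
    ext j; fin_cases j <;> simp [ff'_apply, Matrix.vecHead, Matrix.vecTail]

variable {X x φ}

/-- `RudHom.toM` is a retraction of `RudHom.fromM` as soon as `φ` is dual to the image of `x₂`. -/
lemma RudHom.toM_fromM (h₀ : φ x = 0) (h₁ : φ (X.e' (X.f x)) = 1) :
    (∀ v, (RudHom.toM X φ).1.1 ((RudHom.fromM X x).1.1 v) = v) ∧
      ∀ u, (RudHom.toM X φ).1.2 ((RudHom.fromM X x).1.2 u) = u := by
  have h₂ : φ (X.f' (X.e x)) = -1 := by simpa [e'f_apply, neg_eq_iff_eq_neg] using h₁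
  constructor
  · intro (v : Fin 2 → k)
    change LinearMap.pi ![φ ∘ₗ X.e' ∘ₗ X.f, φ]
      (Fintype.linearCombination k ![x, X.e' (X.f x)] v) = v
    ext j
    fin_cases j <;>
      simp [Fintype.linearCombination_apply, h₀, h₂, e'f_apply, ff'_apply]
  · intro (u : Fin 2 → k)
    change LinearMap.pi ![-(φ ∘ₗ X.f'), φ ∘ₗ X.e']
      (Fintype.linearCombination k ![X.e x, X.f x] u) = u
    ext j
    fin_cases j <;>
      simp [Fintype.linearCombination_apply, h₂, e'f_apply, e'e_apply, f'f_apply]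

end Retract

lemma repM_not_isZero : ¬ (repM k).IsZero := fun h =>
  one_ne_zero (congrFun (@Subsingleton.elim _ h.1 (fun _ : Fin 2 => (1 : k)) (fun _ => 0)) 0)

/-- An indecomposable representation on which `e'f` does not vanish is isomorphic to `M`. -/
lemma RudRep.Indec.iso_repM {X : RudRep k} (hX : X.Indec) (h : X.e' ∘ₗ X.f ≠ 0) :
    RudIso X (repM k) := by
  obtain ⟨z, hz⟩ : ∃ z, X.e' (X.f z) ≠ 0 := by
    by_contra! hc
    exact h (LinearMap.ext hc)
  obtain ⟨φ, hφ⟩ : ∃ φ : X.V₁ →ₗ[k] k, φ (X.e' (X.f z)) = 1 := by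
    obtain ⟨ψ, hψ⟩ : ∃ ψ : Module.Dual k X.V₁, ψ (X.e' (X.f z)) ≠ 0 := by
      by_contra! hc
      exact hz ((Module.forall_dual_apply_eq_zero_iff k _).1 hc)
    exact ⟨(ψ (X.e' (X.f z)))⁻¹ • ψ, inv_mul_cancel₀ hψ⟩
  set x := z - φ z • X.e' (X.f z) with hx
  have hx₀ : φ x = 0 := by simp [hx, hφ]
  have hx₁ : φ (X.e' (X.f x)) = 1 := by
    have : X.f (X.e' (X.f z)) = 0 := by simp [X.e'f_apply, X.ff'_apply]
    simp [hx, this, hφ]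
  obtain ⟨h₁, h₂⟩ := RudHom.toM_fromM hx₀ hx₁
  exact hX.iso_of_retract repM_not_isZero (RudHom.fromM X x) (RudHom.toM X φ) h₁ h₂

lemma RudIso.sigma {X Y : RudRep k} (h : RudIso X Y) : RudIso X.sigma Y.sigma := by
  obtain ⟨⟨⟨a, b⟩, h₁, h₂, h₃, h₄⟩, ha, hb⟩ := h
  exact ⟨⟨(b, a), h₃, h₄, h₁, h₂⟩, hb, ha⟩

lemma RudRep.Indec.sigma {X : RudRep k} (h : X.Indec) : X.sigma.Indec :=
  ⟨fun hz => h.1 hz.symm, fun Y Z hYZ =>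
    (h.2 Y.sigma Z.sigma hYZ.sigma).imp And.symm And.symm⟩

/-- If all composites of a primed and an unprimed map vanish on an indecomposable
representation, then the primed or the unprimed maps vanish. -/
lemma RudRep.Indec.eq_zero_or_eq_zero {X : RudRep k} (hX : X.Indec) (h : X.e' ∘ₗ X.f = 0)
    (h' : X.e ∘ₗ X.f' = 0) : (X.e = 0 ∧ X.f = 0) ∨ (X.e' = 0 ∧ X.f' = 0) := by
  have hf'e : X.f' ∘ₗ X.e = 0 := by simpa [h] using X.rel_e'f.symm
  have hfe' : X.f ∘ₗ X.e' = 0 := by simpa [h'] using X.rel_ef'.symm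
  set I₁ := LinearMap.range X.e' ⊔ LinearMap.range X.f' with hI₁
  set I₂ := LinearMap.range X.e ⊔ LinearMap.range X.f with hI₂
  have ke : I₁ ≤ LinearMap.ker X.e :=
    sup_le (LinearMap.range_le_ker_iff.2 X.rel_ee') (LinearMap.range_le_ker_iff.2 h')
  have kf : I₁ ≤ LinearMap.ker X.f :=
    sup_le (LinearMap.range_le_ker_iff.2 hfe') (LinearMap.range_le_ker_iff.2 X.rel_ff')
  have ke' : I₂ ≤ LinearMap.ker X.e' :=
    sup_le (LinearMap.range_le_ker_iff.2 X.rel_e'e) (LinearMap.range_le_ker_iff.2 h)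
  have kf' : I₂ ≤ LinearMap.ker X.f' :=
    sup_le (LinearMap.range_le_ker_iff.2 hf'e) (LinearMap.range_le_ker_iff.2 X.rel_f'f)
  have me : ∀ v, X.e v ∈ I₂ := fun v => Submodule.mem_sup_left ⟨v, rfl⟩
  have mf : ∀ v, X.f v ∈ I₂ := fun v => Submodule.mem_sup_right ⟨v, rfl⟩
  have me' : ∀ u, X.e' u ∈ I₁ := fun u => Submodule.mem_sup_left ⟨u, rfl⟩
  have mf' : ∀ u, X.f' u ∈ I₁ := fun u => Submodule.mem_sup_right ⟨u, rfl⟩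
  obtain ⟨C₁, hC₁⟩ := Submodule.exists_isCompl I₁
  obtain ⟨C₂, hC₂⟩ := Submodule.exists_isCompl I₂
  rcases hX.eq_bot_or_eq_bot hC₁.symm hC₂ (fun v _ => me v) (fun v _ => mf v)
    (fun u hu => by rw [LinearMap.mem_ker.1 (ke' hu)]; exact zero_mem _)
    (fun u hu => by rw [LinearMap.mem_ker.1 (kf' hu)]; exact zero_mem _)
    (fun v hv => by rw [LinearMap.mem_ker.1 (ke hv)]; exact zero_mem _)
    (fun v hv => by rw [LinearMap.mem_ker.1 (kf hv)]; exact zero_mem _)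
    (fun u _ => me' u) (fun u _ => mf' u) with ⟨-, h₂⟩ | ⟨h₁, -⟩
  · rw [hI₂, sup_eq_bot_iff, LinearMap.range_eq_bot, LinearMap.range_eq_bot] at h₂
    exact Or.inl h₂
  · rw [hI₁, sup_eq_bot_iff, LinearMap.range_eq_bot, LinearMap.range_eq_bot] at h₁
    exact Or.inr h₁

/-- Every indecomposable finite-dimensional representation of the
Rudakov quiver over a field `k`, other than `M` and `M'`, satisfies
either `e = f = 0` or `e' = f' = 0`. -/
theorem rudakov_indecomposable_classification (k : Type) [Field k] (X : RudRep k)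
    (hX : X.Indec) (hM : ¬ RudIso X (repM k)) (hM' : ¬ RudIso X (repM' k)) :
    (X.e = 0 ∧ X.f = 0) ∨ (X.e' = 0 ∧ X.f' = 0) := by
  refine hX.eq_zero_or_eq_zero (by_contra fun h => hM (hX.iso_repM h)) ?_
  refine by_contra fun h => hM' (hX.sigma.iso_repM fun h0 => h ?_).sigma
  rw [X.rel_ef', neg_eq_zero]
  exact neg_eq_zero.1 (X.rel_ef'.symm.trans h0)
end
end

section
/- For any finite-dimensional representation Y of the Rudakov quiver Q_Rud over a field k, there are k-vector space isomorphisms Hom_{Q_Rud}(M, Y) ≅ Y_1, Hom_{Q_Rud}(M', Y) ≅ Y_2, Hom_{Q_Rud}(Y, M) ≅ Y_1^* and Hom_{Q_Rud}(Y, M') ≅ Y_2^*, where Y_1^*, Y_2^* denote the k-linear duals of the vector spaces at vertices 1 and 2. -/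
open scoped Classical
set_option maxHeartbeats 1000000

noncomputable section

variable {k : Type} [Field k]

@[simp] lemma repM_e_apply (v : Fin 2 → k) : (repM k).e v = ![v 0, 0] := by
  change Matrix.toLin' !![(1 : k), 0; 0, 0] v = _
  ext i; fin_cases i <;> simp [Matrix.mulVec, dotProduct, Fin.sum_univ_two]

@[simp] lemma repM_f_apply (v : Fin 2 → k) : (repM k).f v = ![0, v 0] := by
  change Matrix.toLin' !![(0 : k), 0; 1, 0] v = _
  ext i; fin_cases i <;> simp [Matrix.mulVec, dotProduct, Fin.sum_univ_two]

@[simp] lemma repM_e'_apply (w : Fin 2 → k) : (repM k).e' w = ![0, w 1] := by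
  change Matrix.toLin' !![(0 : k), 0; 0, 1] w = _
  ext i; fin_cases i <;> simp [Matrix.mulVec, dotProduct, Fin.sum_univ_two]

@[simp] lemma repM_f'_apply (w : Fin 2 → k) : (repM k).f' w = ![0, -w 0] := by
  change Matrix.toLin' !![(0 : k), 0; -1, 0] w = _
  ext i; fin_cases i <;> simp [Matrix.mulVec, dotProduct, Fin.sum_univ_two]

/-- The linear map `k² → V` sending the standard basis to `a`, `b`. -/
def linOfPair {V : Type} [AddCommGroup V] [Module k V] (a b : V) : (Fin 2 → k) →ₗ[k] V :=
  (LinearMap.proj 0).smulRight a + (LinearMap.proj 1).smulRight b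

@[simp] lemma linOfPair_apply {V : Type} [AddCommGroup V] [Module k V] (a b : V)
    (v : Fin 2 → k) : linOfPair a b v = v 0 • a + v 1 • b := rfl

lemma linOfPair_map {V : Type} [AddCommGroup V] [Module k V] (φ : (Fin 2 → k) →ₗ[k] V) :
    linOfPair (φ ![1, 0]) (φ ![0, 1]) = φ := by
  refine LinearMap.ext fun v => ?_
  rw [linOfPair_apply, ← map_smul, ← map_smul, ← map_add]
  congr 1
  ext i; fin_cases i <;> simp

/-- The linear map `V → k²` with coordinates `α`, `β`. -/
def linToPair {V : Type} [AddCommGroup V] [Module k V] (α β : Module.Dual k V) :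
    V →ₗ[k] (Fin 2 → k) :=
  LinearMap.pi ![α, β]

@[simp] lemma linToPair_apply {V : Type} [AddCommGroup V] [Module k V]
    (α β : Module.Dual k V) (v : V) : linToPair α β v = ![α v, β v] := by
  ext i; fin_cases i <;> rfl

/-- The morphism `M → Y` sending the generator `x₁` to `y`. -/
def homFromM (Y : RudRep k) (y : Y.V₁) : RudHomS (repM k) Y :=
  ⟨(linOfPair y (Y.e' (Y.f y)), linOfPair (Y.e y) (Y.f y)), by
    refine ⟨?_, ?_, ?_, ?_⟩ <;> refine LinearMap.ext fun (v : Fin 2 → k) => ?_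
    · change Y.e (linOfPair _ _ v) = linOfPair _ _ ((repM k).e v)
      simp [Y.ee'_apply]
    · change Y.f (linOfPair _ _ v) = linOfPair _ _ ((repM k).f v)
      simp [Y.e'f_apply, Y.ff'_apply]
    · change Y.e' (linOfPair _ _ v) = linOfPair _ _ ((repM k).e' v)
      simp [Y.e'e_apply]
    · change Y.f' (linOfPair _ _ v) = linOfPair _ _ ((repM k).f' v)
      simp [Y.e'f_apply, Y.f'f_apply]⟩

/-- The morphism `Y → M` whose component at vertex `1` has `x₂`-coordinate `ξ`. -/
def homToM (Y : RudRep k) (ξ : Module.Dual k Y.V₁) : RudHomS Y (repM k) :=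
  ⟨(linToPair (ξ ∘ₗ Y.e' ∘ₗ Y.f) ξ, linToPair (-(ξ ∘ₗ Y.f')) (ξ ∘ₗ Y.e')), by
    refine ⟨?_, ?_, ?_, ?_⟩ <;> refine LinearMap.ext fun v => ?_
    · change (repM k).e (linToPair _ _ v) = linToPair _ _ (Y.e v)
      simp [Y.e'e_apply, Y.e'f_apply]
      rfl
    · change (repM k).f (linToPair _ _ v) = linToPair _ _ (Y.f v)
      simp [Y.f'f_apply]
      rfl
    · change (repM k).e' (linToPair _ _ v) = linToPair _ _ (Y.e' v)
      simp [Y.e'f_apply, Y.ee'_apply]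
      rfl
    · change (repM k).f' (linToPair _ _ v) = linToPair _ _ (Y.f' v)
      simp [Y.ff'_apply]
      rfl⟩

/-- Evaluation at the generator `x₁` identifies `Hom(M, Y)` with `Y₁`. -/
def homFromMEquiv (Y : RudRep k) : RudHomS (repM k) Y ≃ₗ[k] Y.V₁ where
  toFun φ := φ.1.1 (![1, 0] : Fin 2 → k)
  map_add' _ _ := rfl
  map_smul' _ _ := rfl
  invFun := homFromM Y
  left_inv := by
    rintro ⟨⟨φ₁, φ₂⟩, he, hf, he', hf'⟩
    change (Fin 2 → k) →ₗ[k] Y.V₁ at φ₁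
    change (Fin 2 → k) →ₗ[k] Y.V₂ at φ₂
    have e1 : Y.e (φ₁ ![1, 0]) = φ₂ ![1, 0] :=
      (DFunLike.congr_fun he (![1, 0] : Fin 2 → k)).trans
        (congrArg φ₂ ((repM_e_apply _).trans rfl))
    have f1 : Y.f (φ₁ ![1, 0]) = φ₂ ![0, 1] :=
      (DFunLike.congr_fun hf (![1, 0] : Fin 2 → k)).trans
        (congrArg φ₂ ((repM_f_apply _).trans rfl))
    have e2 : Y.e' (φ₂ ![0, 1]) = φ₁ ![0, 1] :=
      (DFunLike.congr_fun he' (![0, 1] : Fin 2 → k)).trans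
        (congrArg φ₁ ((repM_e'_apply _).trans rfl))
    refine Subtype.ext (Prod.ext ?_ ?_)
    · change linOfPair (φ₁ ![1, 0]) (Y.e' (Y.f (φ₁ ![1, 0]))) = φ₁
      rw [f1, e2, linOfPair_map]
    · change linOfPair (Y.e (φ₁ ![1, 0])) (Y.f (φ₁ ![1, 0])) = φ₂
      rw [f1, e1, linOfPair_map]
  right_inv y := by
    change linOfPair _ _ ![1, 0] = y
    simp

/-- The `x₂`-coordinate at vertex `1` identifies `Hom(Y, M)` with the dual of `Y₁`. -/
def homToMEquiv (Y : RudRep k) : RudHomS Y (repM k) ≃ₗ[k] Module.Dual k Y.V₁ where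
  toFun φ := (LinearMap.proj 1 : (Fin 2 → k) →ₗ[k] k) ∘ₗ φ.1.1
  map_add' _ _ := rfl
  map_smul' _ _ := rfl
  invFun := homToM Y
  left_inv := by
    rintro ⟨⟨φ₁, φ₂⟩, he, hf, he', hf'⟩
    change Y.V₁ →ₗ[k] (Fin 2 → k) at φ₁
    change Y.V₂ →ₗ[k] (Fin 2 → k) at φ₂
    have f0 (v) : φ₁ v 0 = φ₂ (Y.f v) 1 := by
      have h : (repM k).f (φ₁ v) = φ₂ (Y.f v) := DFunLike.congr_fun hf v
      rw [← h, repM_f_apply]; rfl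
    have e1 (w) : φ₂ w 1 = φ₁ (Y.e' w) 1 := by
      have h : (repM k).e' (φ₂ w) = φ₁ (Y.e' w) := DFunLike.congr_fun he' w
      rw [← h, repM_e'_apply]; rfl
    have f1 (w) : -φ₂ w 0 = φ₁ (Y.f' w) 1 := by
      have h : (repM k).f' (φ₂ w) = φ₁ (Y.f' w) := DFunLike.congr_fun hf' w
      rw [← h, repM_f'_apply]; rfl
    refine Subtype.ext (Prod.ext ?_ ?_) <;> refine LinearMap.ext fun v => ?_
    · change linToPair _ _ v = φ₁ v
      ext i; fin_cases i
      · simp [f0, e1]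
      · simp
    · change linToPair _ _ v = φ₂ v
      ext i; fin_cases i
      · simp [← f1]
      · simp [e1]
  right_inv ξ := by
    refine LinearMap.ext fun v => ?_
    change linToPair _ _ v 1 = ξ v
    simp

/-- Swapping components identifies `Hom(X, Y)` with `Hom(σ X, σ Y)`. -/
def homSigmaEquiv (X Y : RudRep k) : RudHomS X Y ≃ₗ[k] RudHomS X.sigma Y.sigma where
  toFun φ := ⟨φ.1.swap, φ.2.2.2.1, φ.2.2.2.2, φ.2.1, φ.2.2.1⟩
  map_add' _ _ := rfl
  map_smul' _ _ := rfl
  invFun φ := ⟨φ.1.swap, φ.2.2.2.1, φ.2.2.2.2, φ.2.1, φ.2.2.1⟩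
  left_inv _ := rfl
  right_inv _ := rfl

/-- For any finite-dimensional representation `Y` of `Q_Rud`, there are
`k`-linear isomorphisms `Hom(M, Y) ≅ Y₁`, `Hom(M', Y) ≅ Y₂`, `Hom(Y, M) ≅ Y₁*` and
`Hom(Y, M') ≅ Y₂*`. -/
theorem hom_with_M_and_M' (k : Type) [Field k] (Y : RudRep k) :
    Nonempty (↥(RudHomS (repM k) Y) ≃ₗ[k] Y.V₁) ∧
    Nonempty (↥(RudHomS (repM' k) Y) ≃ₗ[k] Y.V₂) ∧
    Nonempty (↥(RudHomS Y (repM k)) ≃ₗ[k] Module.Dual k Y.V₁) ∧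
    Nonempty (↥(RudHomS Y (repM' k)) ≃ₗ[k] Module.Dual k Y.V₂) := by
  exact ⟨⟨homFromMEquiv Y⟩,
    ⟨(homSigmaEquiv (repM k) Y.sigma).symm.trans (homFromMEquiv Y.sigma)⟩,
    ⟨homToMEquiv Y⟩,
    ⟨(homSigmaEquiv Y.sigma (repM k)).symm.trans (homToMEquiv Y.sigma)⟩⟩
end
end

section
/- The extension-by-zero functor from finite-dimensional representations of the Kronecker quiver Q_K to finite-dimensional representations of the Rudakov quiver Q_Rud (keeping the same vector spaces and maps e, f, and setting e' = f' = 0) is exact and fully faithful, and it restricts to an equivalence between the full subcategory of (e,f)-saturated Kronecker representations and the full subcategory of (e,f)-saturated Q_Rud-representations. Moreover, the full subcategory of (e,f)-saturated Q_Rud-representations is closed under extensions. -/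
open scoped Classical
set_option maxHeartbeats 1000000

noncomputable section

variable {k : Type} [Field k]

namespace RudRep

/-- `(e,f)`-injective: `ker e ⊓ ker f = ⊥`. -/
def EFInj (X : RudRep k) : Prop := LinearMap.ker X.e ⊓ LinearMap.ker X.f = ⊥
/-- `(e,f)`-surjective: `range e ⊔ range f = ⊤`. -/
def EFSurj (X : RudRep k) : Prop := LinearMap.range X.e ⊔ LinearMap.range X.f = ⊤
/-- `(e,f)`-saturated. -/
def EFSat (X : RudRep k) : Prop := X.EFInj ∧ X.EFSurj
/-- `(e',f')`-injective. -/
def EF'Inj (X : RudRep k) : Prop := LinearMap.ker X.e' ⊓ LinearMap.ker X.f' = ⊥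
/-- `(e',f')`-surjective. -/
def EF'Surj (X : RudRep k) : Prop := LinearMap.range X.e' ⊔ LinearMap.range X.f' = ⊤
/-- `(e',f')`-saturated. -/
def EF'Sat (X : RudRep k) : Prop := X.EF'Inj ∧ X.EF'Surj

end RudRep

/-- `0 → B → E → A → 0` is a short exact sequence. -/
structure IsSES {B E A : RudRep k} (ι : RudHom B E) (π : RudHom E A) : Prop where
  inj₁ : Function.Injective ι.1.1
  inj₂ : Function.Injective ι.1.2
  surj₁ : Function.Surjective π.1.1
  surj₂ : Function.Surjective π.1.2
  ex₁ : LinearMap.range ι.1.1 = LinearMap.ker π.1.1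
  ex₂ : LinearMap.range ι.1.2 = LinearMap.ker π.1.2

/-- A surjection splits iff it admits a section. -/
def Splits {E A : RudRep k} (π : RudHom E A) : Prop :=
  ∃ s : RudHom A E, RudHom.comp π s = RudHom.idHom A

/-- `Ext¹(A, B) = 0`: every short exact sequence `0 → B → E → A → 0` splits. -/
def Ext1IsZero (A B : RudRep k) : Prop :=
  ∀ (E : RudRep k) (ι : RudHom B E) (π : RudHom E A), IsSES ι π → Splits π

/-- An extension of `A` by `B`, i.e. a short exact sequence `0 → B → E → A → 0`. -/
structure RudExtn (A B : RudRep k) : Type 1 where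
  E : RudRep k
  ι : RudHom B E
  π : RudHom E A
  ses : IsSES ι π

/-- Equivalence of extensions (Yoneda-Ext equivalence: an isomorphism of middle terms
commuting with the inclusions and projections). -/
def RudExtnEquiv {A B : RudRep k} (x y : RudExtn A B) : Prop :=
  ∃ φ : RudHom x.E y.E, Function.Bijective φ.1.1 ∧ Function.Bijective φ.1.2 ∧
    RudHom.comp φ x.ι = y.ι ∧ RudHom.comp y.π φ = x.π

/-- The number of equivalence classes of extensions of `A` by `B`
(equal to the cardinality of `Ext¹(A,B)` for a finitary category). -/
def ext1Card (A B : RudRep k) : ℕ :=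
  Nat.card (Quot (RudExtnEquiv (A := A) (B := B)))

/-- A finite-dimensional representation of the Kronecker quiver. -/
structure KronRep (k : Type) [Field k] : Type 1 where
  V₁ : Type
  V₂ : Type
  [acg₁ : AddCommGroup V₁]
  [acg₂ : AddCommGroup V₂]
  [mod₁ : Module k V₁]
  [mod₂ : Module k V₂]
  [fd₁ : FiniteDimensional k V₁]
  [fd₂ : FiniteDimensional k V₂]
  e : V₁ →ₗ[k] V₂
  f : V₁ →ₗ[k] V₂

attribute [instance] KronRep.acg₁ KronRep.acg₂ KronRep.mod₁ KronRep.mod₂ KronRep.fd₁ KronRep.fd₂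

/-- The extension-by-zero functor on objects. -/
def KronRep.toRud (X : KronRep k) : RudRep k := RudRep.ofKron X.e X.f

/-- Morphisms of Kronecker representations. -/
def KronHomS (X Y : KronRep k) :
    Submodule k ((X.V₁ →ₗ[k] Y.V₁) × (X.V₂ →ₗ[k] Y.V₂)) where
  carrier := {p | Y.e ∘ₗ p.1 = p.2 ∘ₗ X.e ∧ Y.f ∘ₗ p.1 = p.2 ∘ₗ X.f}
  add_mem' := by
    intro a b ha hb
    obtain ⟨ha1, ha2⟩ := ha
    obtain ⟨hb1, hb2⟩ := hb
    refine ⟨?_, ?_⟩ <;>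
      simp only [Prod.fst_add, Prod.snd_add, LinearMap.add_comp, LinearMap.comp_add,
        ha1, ha2, hb1, hb2]
  zero_mem' := by refine ⟨?_, ?_⟩ <;> simp
  smul_mem' := by
    intro c a ha
    obtain ⟨h1, h2⟩ := ha
    refine ⟨?_, ?_⟩ <;>
      simp only [Prod.smul_fst, Prod.smul_snd, LinearMap.smul_comp, LinearMap.comp_smul, h1, h2]

abbrev KronHom (X Y : KronRep k) : Type := ↥(KronHomS X Y)

/-- The extension-by-zero functor on morphisms. -/
def KronHom.toRud {X Y : KronRep k} (g : KronHom X Y) : RudHom X.toRud Y.toRud := by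
  refine ⟨g.1, ?_, ?_, ?_, ?_⟩
  · exact g.2.1
  · exact g.2.2
  · show (0 : _ →ₗ[k] _) ∘ₗ g.1.2 = g.1.1 ∘ₗ (0 : _ →ₗ[k] _); simp
  · show (0 : _ →ₗ[k] _) ∘ₗ g.1.2 = g.1.1 ∘ₗ (0 : _ →ₗ[k] _); simp

/-- Isomorphism of Kronecker representations. -/
def KronIso (X Y : KronRep k) : Prop :=
  ∃ g : KronHom X Y, Function.Bijective g.1.1 ∧ Function.Bijective g.1.2

/-- `0 → B → E → A → 0` is a short exact sequence of Kronecker representations. -/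
structure IsSESK {B E A : KronRep k} (ι : KronHom B E) (π : KronHom E A) : Prop where
  inj₁ : Function.Injective ι.1.1
  inj₂ : Function.Injective ι.1.2
  surj₁ : Function.Surjective π.1.1
  surj₂ : Function.Surjective π.1.2
  ex₁ : LinearMap.range ι.1.1 = LinearMap.ker π.1.1
  ex₂ : LinearMap.range ι.1.2 = LinearMap.ker π.1.2

namespace KronRep
/-- `(e,f)`-injective Kronecker representation. -/
def EFInj (X : KronRep k) : Prop := LinearMap.ker X.e ⊓ LinearMap.ker X.f = ⊥
/-- `(e,f)`-surjective Kronecker representation. -/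
def EFSurj (X : KronRep k) : Prop := LinearMap.range X.e ⊔ LinearMap.range X.f = ⊤
/-- `(e,f)`-saturated Kronecker representation. -/
def EFSat (X : KronRep k) : Prop := X.EFInj ∧ X.EFSurj
end KronRep

namespace RudRep

lemma EFInj.eq_zero {X : RudRep k} (h : X.EFInj) {x : X.V₁} (he : X.e x = 0) (hf : X.f x = 0) :
    x = 0 := by
  have hx : x ∈ LinearMap.ker X.e ⊓ LinearMap.ker X.f := ⟨he, hf⟩
  rw [h] at hx
  simpa using hx

lemma EFSurj.exists_eq_add {X : RudRep k} (h : X.EFSurj) (y : X.V₂) :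
    ∃ a b, X.e a + X.f b = y := by
  have hy : y ∈ LinearMap.range X.e ⊔ LinearMap.range X.f := h ▸ Submodule.mem_top
  obtain ⟨_, ⟨a, rfl⟩, _, ⟨b, rfl⟩, hab⟩ := Submodule.mem_sup.mp hy
  exact ⟨a, b, hab⟩

lemma EFInj.f'_e_apply {X : RudRep k} (h : X.EFInj) (x : X.V₁) : X.f' (X.e x) = 0 :=
  h.eq_zero (by rw [X.ef'_apply, X.e'e_apply, map_zero, neg_zero]) (X.ff'_apply _)

lemma EFInj.e'_f_apply {X : RudRep k} (h : X.EFInj) (x : X.V₁) : X.e' (X.f x) = 0 := by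
  rw [X.e'f_apply, h.f'_e_apply, neg_zero]

lemma EFSat.e'_eq_zero {X : RudRep k} (h : X.EFSat) : X.e' = 0 := by
  apply LinearMap.ext
  intro y
  obtain ⟨a, b, rfl⟩ := h.2.exists_eq_add y
  rw [map_add, X.e'e_apply, h.1.e'_f_apply, add_zero, LinearMap.zero_apply]

lemma EFSat.f'_eq_zero {X : RudRep k} (h : X.EFSat) : X.f' = 0 := by
  apply LinearMap.ext
  intro y
  obtain ⟨a, b, rfl⟩ := h.2.exists_eq_add y
  rw [map_add, X.f'f_apply, h.1.f'_e_apply, add_zero, LinearMap.zero_apply]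

/-- The restriction of a representation of `Q_Rud` to the Kronecker quiver. -/
def toKron (X : RudRep k) : KronRep k where
  V₁ := X.V₁
  V₂ := X.V₂
  e := X.e
  f := X.f

lemma EFSat.toRud_toKron_iso {X : RudRep k} (h : X.EFSat) : RudIso X.toKron.toRud X := by
  refine ⟨⟨(LinearMap.id, LinearMap.id), rfl, rfl, ?_, ?_⟩,
    Function.bijective_id, Function.bijective_id⟩
  · exact h.e'_eq_zero
  · exact h.f'_eq_zero

end RudRep

lemma KronHom.toRud_bijective (X Y : KronRep k) :
    Function.Bijective (fun g : KronHom X Y => KronHom.toRud g) :=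
  ⟨fun _ _ h => Subtype.ext (congrArg (fun u : RudHom X.toRud Y.toRud => u.1) h),
    fun g => ⟨⟨g.1, g.2.1, g.2.2.1⟩, rfl⟩⟩

namespace IsSES

variable {B E A : RudRep k} {ι : RudHom B E} {π : RudHom E A}

lemma efInj (h : IsSES ι π) (hB : B.EFInj) (hA : A.EFInj) : E.EFInj := by
  refine (Submodule.eq_bot_iff _).mpr ?_
  rintro x ⟨he : E.e x = 0, hf : E.f x = 0⟩
  have hπ : x ∈ LinearMap.ker π.1.1 := hA.eq_zero
    ((DFunLike.congr_fun π.2.1 x).trans (by simp [he]))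
    ((DFunLike.congr_fun π.2.2.1 x).trans (by simp [hf]))
  rw [← h.ex₁] at hπ
  obtain ⟨b, rfl⟩ := hπ
  have hb : b = 0 := hB.eq_zero
    (h.inj₂ (((DFunLike.congr_fun ι.2.1 b).symm.trans he).trans (map_zero _).symm))
    (h.inj₂ (((DFunLike.congr_fun ι.2.2.1 b).symm.trans hf).trans (map_zero _).symm))
  rw [hb, map_zero]

lemma efSurj (h : IsSES ι π) (hB : B.EFSurj) (hA : A.EFSurj) : E.EFSurj := by
  refine (Submodule.eq_top_iff').mpr fun y => ?_
  obtain ⟨a, a', ha⟩ := hA.exists_eq_add (π.1.2 y)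
  obtain ⟨x, rfl⟩ := h.surj₁ a
  obtain ⟨x', rfl⟩ := h.surj₁ a'
  have hπe : A.e (π.1.1 x) = π.1.2 (E.e x) := DFunLike.congr_fun π.2.1 x
  have hπf : A.f (π.1.1 x') = π.1.2 (E.f x') := DFunLike.congr_fun π.2.2.1 x'
  have hy : y - (E.e x + E.f x') ∈ LinearMap.ker π.1.2 := by
    rw [LinearMap.mem_ker, map_sub, map_add, ← hπe, ← hπf, ha, sub_self]
  rw [← h.ex₂] at hy
  obtain ⟨b, hb⟩ := hy
  obtain ⟨c, c', rfl⟩ := hB.exists_eq_add b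
  have hιe : E.e (ι.1.1 c) = ι.1.2 (B.e c) := DFunLike.congr_fun ι.2.1 c
  have hιf : E.f (ι.1.1 c') = ι.1.2 (B.f c') := DFunLike.congr_fun ι.2.2.1 c'
  refine Submodule.mem_sup.mpr ⟨_, ⟨x + ι.1.1 c, rfl⟩, _, ⟨x' + ι.1.1 c', rfl⟩, ?_⟩
  rw [map_add, ← hιe, ← hιf] at hb
  rw [map_add, map_add, add_add_add_comm, hb, add_sub_cancel]

end IsSES

/-- The extension-by-zero functor from Kronecker representations to
`Q_Rud`-representations is (i) fully faithful, (ii) exact, (iii) preserves and reflects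
`(e,f)`-saturation, (iv) is essentially surjective onto `(e,f)`-saturated
`Q_Rud`-representations (hence restricts to an equivalence of the saturated
subcategories); moreover (v) the full subcategory of `(e,f)`-saturated
`Q_Rud`-representations is closed under extensions. -/
theorem extension_by_zero_functor (k : Type) [Field k] :
    (∀ X Y : KronRep k, Function.Bijective (fun g : KronHom X Y => KronHom.toRud g)) ∧
    (∀ (X Y Z : KronRep k) (ι : KronHom X Y) (π : KronHom Y Z),
      IsSESK ι π → IsSES (KronHom.toRud ι) (KronHom.toRud π)) ∧
    (∀ X : KronRep k, X.EFSat ↔ X.toRud.EFSat) ∧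
    (∀ Y : RudRep k, Y.EFSat → ∃ X : KronRep k, X.EFSat ∧ RudIso X.toRud Y) ∧
    (∀ (B E A : RudRep k) (ι : RudHom B E) (π : RudHom E A),
      IsSES ι π → B.EFSat → A.EFSat → E.EFSat) := by
  exact ⟨KronHom.toRud_bijective,
    fun _ _ _ _ _ h => ⟨h.inj₁, h.inj₂, h.surj₁, h.surj₂, h.ex₁, h.ex₂⟩,
    fun _ => Iff.rfl,
    fun Y hY => ⟨Y.toKron, hY, hY.toRud_toKron_iso⟩,
    fun _ _ _ _ _ h hB hA => ⟨h.efInj hB.1 hA.1, h.efSurj hB.2 hA.2⟩⟩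
end
end

section
/- Let X = R_φ(1) for some φ ∈ Σ_1, i.e. X is a (1,1)-dimensional representation of Q_Rud over F_q with e' = f' = 0 and (e, f) ≠ (0, 0). Then Ext^1(X, I_0) = 0 and Ext^1(I_0, X) ≅ F_q, where I_0 is the simple representation at vertex 1; the middle term of any non-split short exact sequence 0 → X → E → I_0 → 0 is isomorphic to I_1. -/
open scoped Classical
set_option maxHeartbeats 1000000

noncomputable section

variable {k : Type} [Field k]

/-- The matrix of the inclusion of `k^n` into the first `n` coordinates of `k^{n+1}`. -/
def inclFirstMat (k : Type) [Field k] (n : ℕ) : Matrix (Fin (n + 1)) (Fin n) k :=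
  Matrix.of fun j i => if (j : ℕ) = (i : ℕ) then 1 else 0

/-- The matrix of the inclusion of `k^n` into the last `n` coordinates of `k^{n+1}`. -/
def inclLastMat (k : Type) [Field k] (n : ℕ) : Matrix (Fin (n + 1)) (Fin n) k :=
  Matrix.of fun j i => if (j : ℕ) = (i : ℕ) + 1 then 1 else 0

/-- The pre-projective representation `P_n` of dimension `(n, n+1)`, with `e` the inclusion
into the first `n` coordinates, `f` the inclusion into the last `n`, and `e' = f' = 0`. -/
def Prep (k : Type) [Field k] (n : ℕ) : RudRep k :=
  RudRep.ofKron (Matrix.toLin' (inclFirstMat k n)) (Matrix.toLin' (inclLastMat k n))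

/-- The pre-injective representation `I_n` of dimension `(n+1, n)`, with `e` the projection
onto the first `n` coordinates, `f` the projection onto the last `n`, and `e' = f' = 0`. -/
def Irep (k : Type) [Field k] (n : ℕ) : RudRep k :=
  RudRep.ofKron (Matrix.toLin' (inclFirstMat k n).transpose)
    (Matrix.toLin' (inclLastMat k n).transpose)

/-- `φ ∈ Σ`: `φ` is a monic irreducible polynomial, or the zero polynomial. -/
def InSigma (φ : Polynomial k) : Prop := φ = 0 ∨ (φ.Monic ∧ Irreducible φ)

/-- `φ ∈ Σ₁`: `φ` is a monic polynomial of degree 1, or the zero polynomial. -/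
def InSigma1 (φ : Polynomial k) : Prop := φ = 0 ∨ (φ.Monic ∧ φ.natDegree = 1)

/-- The degree of an element of `Σ`, with the convention `deg 0 = 1`. -/
def sigDeg (φ : Polynomial k) : ℕ := if φ = 0 then 1 else φ.natDegree

/-- The `d × d` companion matrix of a monic polynomial of degree `d`. -/
def companionMat (d : ℕ) (φ : Polynomial k) : Matrix (Fin d) (Fin d) k :=
  Matrix.of fun i j =>
    if (j : ℕ) + 1 = d then -φ.coeff (i : ℕ) else if (i : ℕ) = (j : ℕ) + 1 then 1 else 0

/-- The `dn × dn` block matrix with `n` diagonal blocks equal to `C` and `d × d`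
identity blocks on the superdiagonal. -/
def Mblock {d : ℕ} (C : Matrix (Fin d) (Fin d) k) (n : ℕ) :
    Matrix (Fin n × Fin d) (Fin n × Fin d) k :=
  Matrix.of fun p q =>
    if p.1 = q.1 then C p.2 q.2
    else if (q.1 : ℕ) = (p.1 : ℕ) + 1 ∧ p.2 = q.2 then 1 else 0

/-- The regular representation `R_φ(n)` for `φ ∈ Σ`: for `φ ≠ 0` this is
`(e, f) = (Id, M_φ(n))` and `e' = f' = 0`; for `φ = 0` it is `(e, f) = (J_n, Id)`. -/
def Rrep (φ : Polynomial k) (n : ℕ) : RudRep k :=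
  if φ = 0 then
    RudRep.ofKron (Matrix.toLin' (Mblock (0 : Matrix (Fin 1) (Fin 1) k) n))
      (Matrix.toLin' (1 : Matrix (Fin n × Fin 1) (Fin n × Fin 1) k))
  else
    RudRep.ofKron
      (Matrix.toLin' (1 : Matrix (Fin n × Fin φ.natDegree) (Fin n × Fin φ.natDegree) k))
      (Matrix.toLin' (Mblock (companionMat φ.natDegree φ) n))

namespace RudHom

variable {X Y : RudRep k}

lemma e_apply (g : RudHom X Y) (x : X.V₁) : Y.e (g.1.1 x) = g.1.2 (X.e x) :=
  DFunLike.congr_fun g.2.1 x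

lemma f_apply (g : RudHom X Y) (x : X.V₁) : Y.f (g.1.1 x) = g.1.2 (X.f x) :=
  DFunLike.congr_fun g.2.2.1 x

lemma e'_apply (g : RudHom X Y) (y : X.V₂) : Y.e' (g.1.2 y) = g.1.1 (X.e' y) :=
  DFunLike.congr_fun g.2.2.2.1 y

lemma f'_apply (g : RudHom X Y) (y : X.V₂) : Y.f' (g.1.2 y) = g.1.1 (X.f' y) :=
  DFunLike.congr_fun g.2.2.2.2 y

lemma ext_apply {g h : RudHom X Y} (h₁ : ∀ x, g.1.1 x = h.1.1 x)
    (h₂ : ∀ y, g.1.2 y = h.1.2 y) : g = h :=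
  Subtype.ext (Prod.ext (LinearMap.ext h₁) (LinearMap.ext h₂))

end RudHom

namespace IsSES

variable {B E A : RudRep k} {ι : RudHom B E} {π : RudHom E A}

lemma π_ι₁ (h : IsSES ι π) (x : B.V₁) : π.1.1 (ι.1.1 x) = 0 :=
  LinearMap.mem_ker.1 (h.ex₁ ▸ LinearMap.mem_range_self _ x)

lemma exists_ι₁ (h : IsSES ι π) {w : E.V₁} (hw : π.1.1 w = 0) : ∃ x, ι.1.1 x = w := by
  have : w ∈ LinearMap.range ι.1.1 := by rw [h.ex₁]; exact hw
  exact this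

lemma exists_ι₂ (h : IsSES ι π) {w : E.V₂} (hw : π.1.2 w = 0) : ∃ x, ι.1.2 x = w := by
  have : w ∈ LinearMap.range ι.1.2 := by rw [h.ex₂]; exact hw
  exact this

end IsSES

/-- Coordinates on a representation concentrated at vertex `1`, where it is a line. -/
structure SimpleAtOne (A : RudRep k) where
  coord : A.V₁ ≃ₗ[k] k
  subsingleton : Subsingleton A.V₂

/-- Coordinates on a `(1, 1)`-dimensional representation with `(e, f) = (α, β) ≠ (0, 0)` and
`e' = f' = 0`. -/
structure KronPoint (X : RudRep k) (α β : k) where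
  coord₁ : X.V₁ ≃ₗ[k] k
  coord₂ : X.V₂ ≃ₗ[k] k
  e_eq : ∀ t, X.e (coord₁.symm t) = coord₂.symm (t * α)
  f_eq : ∀ t, X.f (coord₁.symm t) = coord₂.symm (t * β)
  e'_eq : ∀ y, X.e' y = 0
  f'_eq : ∀ y, X.f' y = 0
  ne : α ≠ 0 ∨ β ≠ 0

lemma exists_mul_eq_of_cross_eq_zero {α β p q : k} (h : α ≠ 0 ∨ β ≠ 0) (hpq : β * p - α * q = 0) :
    ∃ t, p = t * α ∧ q = t * β := by
  rcases h with h | h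
  · refine ⟨p / α, by field_simp, ?_⟩
    field_simp
    linear_combination -hpq
  · refine ⟨q / β, ?_, by field_simp⟩
    field_simp
    linear_combination hpq

lemma exists_cross_eq {α β : k} (h : α ≠ 0 ∨ β ≠ 0) (r : k) : ∃ p q : k, β * p - α * q = r := by
  rcases h with h | h
  · exact ⟨0, -(r / α), by field_simp; ring⟩
  · exact ⟨r / β, 0, by field_simp; ring⟩

namespace KronPoint

variable {X E A : RudRep k} {α β : k}

theorem ext1IsZero_simple (P : KronPoint X α β) (S : SimpleAtOne A) : Ext1IsZero X A := by
  intro E ι π h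
  have := S.subsingleton
  have hinj : Function.Injective π.1.2 := by
    rw [injective_iff_map_eq_zero]
    intro w hw
    obtain ⟨x, rfl⟩ := h.exists_ι₂ hw
    rw [Subsingleton.elim x 0, map_zero]
  obtain ⟨s, hs⟩ := π.1.1.exists_rightInverse_of_surjective (LinearMap.range_eq_top.2 h.surj₁)
  have hs' (x : X.V₁) : π.1.1 (s x) = x := DFunLike.congr_fun hs x
  let t := LinearEquiv.ofBijective π.1.2 ⟨hinj, h.surj₂⟩
  have ht (y : X.V₂) : π.1.2 (t.symm y) = y := t.apply_symm_apply y
  set v := s (P.coord₁.symm 1)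
  set w₀ := t.symm (P.coord₂.symm 1)
  have hev : E.e v = α • w₀ := hinj <| by
    rw [← π.e_apply, hs', P.e_eq, map_smul, ht, ← map_smul]
    simp
  have hfv : E.f v = β • w₀ := hinj <| by
    rw [← π.f_apply, hs', P.f_eq, map_smul, ht, ← map_smul]
    simp
  have hspan (w : E.V₂) : w = P.coord₂ (π.1.2 w) • w₀ := hinj <| by
    rw [map_smul, ht, ← map_smul]
    simp
  have hee := E.e'e_apply v
  have hff := E.f'f_apply v
  have hef := E.e'f_apply v
  rw [hev, map_smul] at hee
  rw [hfv, map_smul] at hff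
  rw [hev, hfv, map_smul, map_smul] at hef
  have hw₀ : E.e' w₀ = 0 ∧ E.f' w₀ = 0 := by
    rcases P.ne with hne | hne
    · have h0 := (smul_eq_zero.1 hee).resolve_left hne
      rw [h0, smul_zero, zero_eq_neg] at hef
      exact ⟨h0, (smul_eq_zero.1 hef).resolve_left hne⟩
    · have h0 := (smul_eq_zero.1 hff).resolve_left hne
      rw [h0, smul_zero, neg_zero] at hef
      exact ⟨(smul_eq_zero.1 hef).resolve_left hne, h0⟩
  have he' (w : E.V₂) : E.e' w = 0 := by rw [hspan w, map_smul, hw₀.1, smul_zero]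
  have hf' (w : E.V₂) : E.f' w = 0 := by rw [hspan w, map_smul, hw₀.2, smul_zero]
  refine ⟨⟨(s, t.symm.toLinearMap), ?_, ?_, ?_, ?_⟩, RudHom.ext_apply hs' ht⟩
  · exact LinearMap.ext fun x => hinj <| by
      simp [← π.e_apply, hs', ht]
  · exact LinearMap.ext fun x => hinj <| by
      simp [← π.f_apply, hs', ht]
  · exact LinearMap.ext fun y => by simp [he', P.e'_eq]
  · exact LinearMap.ext fun y => by simp [hf', P.f'_eq]

/-- `v` lifts the generator of `A`, and `(e v, f v)` is the image of the pair with
coordinates `(p, q)`. -/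
def IsLift (P : KronPoint X α β) (S : SimpleAtOne A) (ι : RudHom X E) (π : RudHom E A)
    (v : E.V₁) (p q : k) : Prop :=
  S.coord (π.1.1 v) = 1 ∧ ι.1.2 (P.coord₂.symm p) = E.e v ∧ ι.1.2 (P.coord₂.symm q) = E.f v

variable {P : KronPoint X α β} {S : SimpleAtOne A} {ι : RudHom X E} {π : RudHom E A}

lemma ι₂_surjective (S : SimpleAtOne A) (h : IsSES ι π) : Function.Surjective ι.1.2 := fun _ =>
  have := S.subsingleton
  h.exists_ι₂ (Subsingleton.elim _ _)

lemma e'_eq_zero (P : KronPoint X α β) (S : SimpleAtOne A) (h : IsSES ι π) (w : E.V₂) :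
    E.e' w = 0 := by
  obtain ⟨y, rfl⟩ := ι₂_surjective S h w
  rw [ι.e'_apply, P.e'_eq, map_zero]

lemma f'_eq_zero (P : KronPoint X α β) (S : SimpleAtOne A) (h : IsSES ι π) (w : E.V₂) :
    E.f' w = 0 := by
  obtain ⟨y, rfl⟩ := ι₂_surjective S h w
  rw [ι.f'_apply, P.f'_eq, map_zero]

lemma exists_isLift (P : KronPoint X α β) (S : SimpleAtOne A) (h : IsSES ι π) :
    ∃ v p q, P.IsLift S ι π v p q := by
  obtain ⟨v, hv⟩ := h.surj₁ (S.coord.symm 1)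
  obtain ⟨y, hy⟩ := ι₂_surjective S h (E.e v)
  obtain ⟨z, hz⟩ := ι₂_surjective S h (E.f v)
  exact ⟨v, P.coord₂ y, P.coord₂ z, by simp [hv], by simp [hy], by simp [hz]⟩

namespace IsLift

variable {v v' : E.V₁} {p q p' q' : k}

lemma add_ι (hv : P.IsLift S ι π v p q) (h : IsSES ι π) (s : k) :
    P.IsLift S ι π (v + ι.1.1 (P.coord₁.symm s)) (p + s * α) (q + s * β) := by
  obtain ⟨h₁, h₂, h₃⟩ := hv
  refine ⟨?_, ?_, ?_⟩
  · rw [map_add, h.π_ι₁, add_zero, h₁]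
  · rw [map_add, map_add, map_add, h₂, ι.e_apply, P.e_eq]
  · rw [map_add, map_add, map_add, h₃, ι.f_apply, P.f_eq]

lemma eq_ι_add_smul (hv : P.IsLift S ι π v p q) (h : IsSES ι π) (w : E.V₁) :
    ∃ s, w = ι.1.1 (P.coord₁.symm s) + S.coord (π.1.1 w) • v := by
  obtain ⟨x, hx⟩ := h.exists_ι₁ (w := w - S.coord (π.1.1 w) • v)
    (S.coord.injective (by simp [hv.1]))
  exact ⟨P.coord₁ x, by rw [P.coord₁.symm_apply_apply, hx, sub_add_cancel]⟩

lemma cross_unique (hv : P.IsLift S ι π v p q) (hv' : P.IsLift S ι π v' p' q') (h : IsSES ι π) :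
    β * p' - α * q' = β * p - α * q := by
  obtain ⟨s, hs⟩ := hv.eq_ι_add_smul h v'
  rw [hv'.1, one_smul, add_comm] at hs
  subst hs
  have hs := hv.add_ι h s
  have hp := P.coord₂.symm.injective (h.inj₂ (hv'.2.1.trans hs.2.1.symm))
  have hq := P.coord₂.symm.injective (h.inj₂ (hv'.2.2.trans hs.2.2.symm))
  rw [hp, hq]
  ring

lemma exists_of_cross_eq (hv : P.IsLift S ι π v p q) (h : IsSES ι π)
    (hr : β * p' - α * q' = β * p - α * q) : ∃ v', P.IsLift S ι π v' p' q' := by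
  obtain ⟨s, hs, hs'⟩ := exists_mul_eq_of_cross_eq_zero P.ne (p := p' - p) (q := q' - q)
    (by linear_combination hr)
  have := hv.add_ι h s
  rw [← hs, ← hs', add_sub_cancel, add_sub_cancel] at this
  exact ⟨_, this⟩

lemma splits (hv : P.IsLift S ι π v 0 0) : Splits π := by
  obtain ⟨h₁, h₂, h₃⟩ := hv
  have := S.subsingleton
  rw [map_zero, map_zero] at h₂ h₃
  refine ⟨⟨(S.coord.toLinearMap.smulRight v, 0), ?_, ?_, ?_, ?_⟩, RudHom.ext_apply ?_ ?_⟩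
  · exact LinearMap.ext fun x => by simp [← h₂]
  · exact LinearMap.ext fun x => by simp [← h₃]
  · exact LinearMap.ext fun y => by simp [Subsingleton.elim y 0]
  · exact LinearMap.ext fun y => by simp [Subsingleton.elim y 0]
  · intro x
    apply S.coord.injective
    simp [RudHom.comp, RudHom.idHom, h₁]
  · exact fun y => Subsingleton.elim _ _

lemma map {x y : RudExtn A X} {v : x.E.V₁} (hv : P.IsLift S x.ι x.π v p q) (φ : RudHom x.E y.E)
    (hι : RudHom.comp φ x.ι = y.ι) (hπ : RudHom.comp y.π φ = x.π) :
    P.IsLift S y.ι y.π (φ.1.1 v) p q := by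
  obtain ⟨h₁, h₂, h₃⟩ := hv
  rw [← hπ] at h₁
  refine ⟨h₁, ?_, ?_⟩
  · rw [φ.e_apply, ← h₂, ← hι]
    rfl
  · rw [φ.f_apply, ← h₃, ← hι]
    rfl

end IsLift

/-- The extension of `A` by `X` in which the generator of `A` has a lift `v` such that
`(e v, f v)` has coordinates `(p, q)`. -/
def stdExtn (P : KronPoint X α β) (S : SimpleAtOne A) (p q : k) : RudExtn A X where
  E := RudRep.ofKron (V := X.V₁ × k) (W := X.V₂)
    (X.e.coprod (LinearMap.toSpanSingleton k _ (P.coord₂.symm p)))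
    (X.f.coprod (LinearMap.toSpanSingleton k _ (P.coord₂.symm q)))
  ι := ⟨(LinearMap.inl k X.V₁ k, LinearMap.id),
    LinearMap.ext fun x =>
      show X.e x + (0 : k) • P.coord₂.symm p = X.e x by rw [zero_smul, add_zero],
    LinearMap.ext fun x =>
      show X.f x + (0 : k) • P.coord₂.symm q = X.f x by rw [zero_smul, add_zero],
    LinearMap.ext fun y => show (0 : X.V₁ × k) = (X.e' y, 0) by rw [P.e'_eq]; rfl,
    LinearMap.ext fun y => show (0 : X.V₁ × k) = (X.f' y, 0) by rw [P.f'_eq]; rfl⟩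
  π := ⟨(S.coord.symm.toLinearMap ∘ₗ LinearMap.snd k X.V₁ k, 0),
    LinearMap.ext fun _ => S.subsingleton.elim _ _,
    LinearMap.ext fun _ => S.subsingleton.elim _ _,
    LinearMap.ext fun _ => show A.e' 0 = S.coord.symm 0 by rw [map_zero, map_zero],
    LinearMap.ext fun _ => show A.f' 0 = S.coord.symm 0 by rw [map_zero, map_zero]⟩
  ses :=
    { inj₁ := LinearMap.inl_injective
      inj₂ := Function.injective_id
      surj₁ := S.coord.symm.surjective.comp LinearMap.snd_surjective
      surj₂ := fun y => ⟨0, S.subsingleton.elim _ _⟩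
      ex₁ := (LinearMap.range_inl k X.V₁ k).trans
        (LinearEquiv.ker_comp S.coord.symm (LinearMap.snd k X.V₁ k)).symm
      ex₂ := LinearMap.range_id.trans LinearMap.ker_zero.symm }

lemma isLift_stdExtn (P : KronPoint X α β) (S : SimpleAtOne A) (p q : k) :
    P.IsLift S (P.stdExtn S p q).ι (P.stdExtn S p q).π ((0, 1) : X.V₁ × k) p q := by
  refine ⟨S.coord.apply_symm_apply 1, ?_, ?_⟩
  · change P.coord₂.symm p = X.e 0 + (1 : k) • P.coord₂.symm p
    rw [map_zero, zero_add, one_smul]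
  · change P.coord₂.symm q = X.f 0 + (1 : k) • P.coord₂.symm q
    rw [map_zero, zero_add, one_smul]

lemma IsLift.stdExtn_equiv {x : RudExtn A X} {v : x.E.V₁} {p q : k}
    (hv : P.IsLift S x.ι x.π v p q) : RudExtnEquiv (P.stdExtn S p q) x := by
  have h := x.ses
  have hπφ (z : X.V₁ × k) : S.coord (x.π.1.1 (x.ι.1.1 z.1 + z.2 • v)) = z.2 := by
    rw [map_add, h.π_ι₁, zero_add, map_smul, map_smul, hv.1, smul_eq_mul, mul_one]
  refine ⟨⟨(x.ι.1.1.coprod (LinearMap.toSpanSingleton k _ v), x.ι.1.2), ?_, ?_, ?_, ?_⟩,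
    ⟨?_, ?_⟩, ⟨h.inj₂, ι₂_surjective (ι := x.ι) S h⟩,
    RudHom.ext_apply ?_ ?_, RudHom.ext_apply ?_ ?_⟩
  · refine LinearMap.ext fun z => ?_
    change x.E.e (x.ι.1.1 z.1 + z.2 • v) = x.ι.1.2 (X.e z.1 + z.2 • P.coord₂.symm p)
    simp only [map_add, map_smul, x.ι.e_apply, hv.2.1]
  · refine LinearMap.ext fun z => ?_
    change x.E.f (x.ι.1.1 z.1 + z.2 • v) = x.ι.1.2 (X.f z.1 + z.2 • P.coord₂.symm q)
    simp only [map_add, map_smul, x.ι.f_apply, hv.2.2]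
  · refine LinearMap.ext fun y => (e'_eq_zero P S h _).trans ?_
    change 0 = x.ι.1.1 0 + (0 : k) • v
    rw [map_zero, zero_smul, add_zero]
  · refine LinearMap.ext fun y => (f'_eq_zero P S h _).trans ?_
    change 0 = x.ι.1.1 0 + (0 : k) • v
    rw [map_zero, zero_smul, add_zero]
  · change Function.Injective (x.ι.1.1.coprod (LinearMap.toSpanSingleton k _ v))
    rw [injective_iff_map_eq_zero]
    rintro ⟨a, t⟩ hz
    have hz' : x.ι.1.1 a + t • v = 0 := hz
    have ht : 0 = t := by simpa [hz'] using hπφ (a, t)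
    subst ht
    rw [zero_smul, add_zero] at hz'
    rw [h.inj₁ (hz'.trans (map_zero _).symm)]
    rfl
  · intro w
    obtain ⟨s, hs⟩ := hv.eq_ι_add_smul h w
    exact ⟨(P.coord₁.symm s, S.coord (x.π.1.1 w)), hs.symm⟩
  · intro z
    change x.ι.1.1 z + (0 : k) • v = x.ι.1.1 z
    rw [zero_smul, add_zero]
  · intro z
    rfl
  · intro z
    exact S.coord.injective ((hπφ z).trans (S.coord.apply_symm_apply _).symm)
  · exact fun _ => S.subsingleton.elim _ _

theorem ext1Card_simple (P : KronPoint X α β) (S : SimpleAtOne A) :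
    ext1Card A X = Nat.card k := by
  choose v p q hv using fun x : RudExtn A X => exists_isLift P S x.ses
  let inv : Quot (RudExtnEquiv (A := A) (B := X)) → k :=
    Quot.lift (fun x => β * p x - α * q x) <| by
      rintro x y ⟨φ, -, -, hι, hπ⟩
      exact (hv y).cross_unique ((hv x).map φ hι hπ) y.ses
  refine Nat.card_congr (Equiv.ofBijective inv ⟨?_, fun r => ?_⟩)
  · rintro ⟨x⟩ ⟨y⟩ hxy
    obtain ⟨w, hw⟩ := (hv y).exists_of_cross_eq y.ses hxy
    exact (Quot.sound (hv x).stdExtn_equiv).symm.trans (Quot.sound hw.stdExtn_equiv)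
  · obtain ⟨a, b, hab⟩ := exists_cross_eq P.ne r
    refine ⟨Quot.mk _ (P.stdExtn S a b), ?_⟩
    rw [← hab]
    exact (isLift_stdExtn P S a b).cross_unique (hv _) (P.stdExtn S a b).ses

theorem rudIso_Irep_one (P : KronPoint X α β) (S : SimpleAtOne A) (h : IsSES ι π)
    (hns : ¬ Splits π) : RudIso E (Irep k 1) := by
  obtain ⟨v, p, q, hv⟩ := exists_isLift P S h
  have hr : β * p - α * q ≠ 0 := fun hr => by
    obtain ⟨v', hv'⟩ := hv.exists_of_cross_eq (p' := 0) (q' := 0) h (by rw [hr]; ring)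
    exact hns hv'.splits
  let c : E.V₂ ≃ₗ[k] k :=
    (LinearEquiv.ofBijective ι.1.2 ⟨h.inj₂, ι₂_surjective S h⟩).symm.trans P.coord₂
  have hc (t : k) : c (ι.1.2 (P.coord₂.symm t)) = t := by
    have := (LinearEquiv.ofBijective ι.1.2 ⟨h.inj₂, ι₂_surjective S h⟩).symm_apply_apply
      (P.coord₂.symm t)
    exact (congrArg P.coord₂ this).trans (P.coord₂.apply_symm_apply t)
  have hce (s t : k) : c (E.e (ι.1.1 (P.coord₁.symm s) + t • v)) = s * α + t * p := by
    rw [map_add, map_smul, ι.e_apply, P.e_eq, ← hv.2.1, map_add, map_smul, hc, hc, smul_eq_mul]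
  have hcf (s t : k) : c (E.f (ι.1.1 (P.coord₁.symm s) + t • v)) = s * β + t * q := by
    rw [map_add, map_smul, ι.f_apply, P.f_eq, ← hv.2.2, map_add, map_smul, hc, hc, smul_eq_mul]
  let g₁ : E.V₁ →ₗ[k] (Fin 2 → k) :=
    LinearMap.pi ![c.toLinearMap ∘ₗ E.e, c.toLinearMap ∘ₗ E.f]
  let g₂ : E.V₂ ≃ₗ[k] (Fin 1 → k) := c.trans (LinearEquiv.funUnique (Fin 1) k k).symm
  have hg₀ (w : E.V₁) : g₁ w 0 = c (E.e w) := rfl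
  have hg₁ (w : E.V₁) : g₁ w 1 = c (E.f w) := rfl
  refine ⟨⟨(g₁, g₂.toLinearMap), ?_, ?_, ?_, ?_⟩, ⟨?_, ?_⟩, g₂.bijective⟩
  · refine LinearMap.ext fun w => funext fun i => ?_
    have : i = 0 := Subsingleton.elim (α := Fin 1) _ _
    subst this
    change Matrix.toLin' (inclFirstMat k 1).transpose (g₁ w) 0 = c (E.e w)
    simp [inclFirstMat, Matrix.mulVec, dotProduct, hg₀]
  · refine LinearMap.ext fun w => funext fun i => ?_
    have : i = 0 := Subsingleton.elim (α := Fin 1) _ _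
    subst this
    change Matrix.toLin' (inclLastMat k 1).transpose (g₁ w) 0 = c (E.f w)
    simp [inclLastMat, Matrix.mulVec, dotProduct, Fin.sum_univ_two, hg₁]
  · refine LinearMap.ext fun w => ?_
    change 0 = g₁ (E.e' w)
    rw [e'_eq_zero P S h, map_zero]
  · refine LinearMap.ext fun w => ?_
    change 0 = g₁ (E.f' w)
    rw [f'_eq_zero P S h, map_zero]
  · change Function.Injective g₁
    rw [injective_iff_map_eq_zero]
    intro w hw
    obtain ⟨s, hs⟩ := hv.eq_ι_add_smul h w
    generalize S.coord (π.1.1 w) = t at hs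
    subst hs
    have h₀ : s * α + t * p = 0 := by rw [← hce, ← hg₀, hw]; rfl
    have h₁ : s * β + t * q = 0 := by rw [← hcf, ← hg₁, hw]; rfl
    have ht : t = 0 := (mul_eq_zero.1 (show t * (β * p - α * q) = 0 by
      linear_combination β * h₀ - α * h₁)).resolve_right hr
    subst ht
    have hs : s = 0 := by
      rcases P.ne with hne | hne
      · simpa [hne] using h₀
      · simpa [hne] using h₁
    subst hs
    simp
  · intro u
    change Fin 2 → k at u
    set t := (β * u 0 - α * u 1) / (β * p - α * q) with ht
    rw [eq_div_iff hr] at ht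
    obtain ⟨s, hs₀, hs₁⟩ := exists_mul_eq_of_cross_eq_zero P.ne (p := u 0 - t * p)
      (q := u 1 - t * q) (by linear_combination -ht)
    refine ⟨ι.1.1 (P.coord₁.symm s) + t • v, funext fun i => ?_⟩
    change Fin 2 at i
    fin_cases i
    · exact (hce s t).trans (by rw [← hs₀]; exact sub_add_cancel _ _)
    · exact (hcf s t).trans (by rw [← hs₁]; exact sub_add_cancel _ _)

end KronPoint

/-- `I₀` is the simple representation at vertex `1`. -/
def simpleAtOneIrep (k : Type) [Field k] : SimpleAtOne (Irep k 0) where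
  coord := LinearEquiv.funUnique (Fin 1) k k
  subsingleton := inferInstanceAs (Subsingleton (Fin 0 → k))

lemma toLin'_funUnique_symm {ι : Type} [Fintype ι] [DecidableEq ι] [Unique ι] (M : Matrix ι ι k)
    (t : k) : Matrix.toLin' M ((LinearEquiv.funUnique ι k k).symm t) =
      (LinearEquiv.funUnique ι k k).symm (t * M default default) := by
  ext i
  simp [Matrix.mulVec, dotProduct, Unique.eq_default i, mul_comm]

/-- Coordinates on the representation given by two `1 × 1` matrices, not both zero. -/
def kronPointOfMatrices {ι : Type} [Fintype ι] [DecidableEq ι] [Unique ι] (M N : Matrix ι ι k)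
    (h : M default default ≠ 0 ∨ N default default ≠ 0) :
    KronPoint (RudRep.ofKron (Matrix.toLin' M) (Matrix.toLin' N))
      (M default default) (N default default) where
  coord₁ := LinearEquiv.funUnique ι k k
  coord₂ := LinearEquiv.funUnique ι k k
  e_eq := toLin'_funUnique_symm M
  f_eq := toLin'_funUnique_symm N
  e'_eq _ := rfl
  f'_eq _ := rfl
  ne := h

lemma exists_kronPoint_Rrep {φ : Polynomial k} (hφ : InSigma1 φ) :
    ∃ α β, Nonempty (KronPoint (Rrep φ 1) α β) := by
  by_cases h0 : φ = 0
  · rw [Rrep, if_pos h0]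
    let _ : Unique (Fin 1 × Fin 1) := Unique.mk' _
    exact ⟨_, _, ⟨kronPointOfMatrices _ _ (by simp)⟩⟩
  · have hd := (hφ.resolve_left h0).2
    rw [Rrep, if_neg h0]
    obtain ⟨_⟩ := Fintype.card_eq_one_iff_nonempty_unique.1
      (show Fintype.card (Fin 1 × Fin φ.natDegree) = 1 by simp [hd])
    exact ⟨_, _, ⟨kronPointOfMatrices _ _ (by simp)⟩⟩

/-- For `X = R_φ(1)` with `φ ∈ Σ₁`: `Ext¹(X, I₀) = 0`,
`Ext¹(I₀, X) ≅ F_q` (it has exactly `q` elements), and the middle term of any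
non-split short exact sequence `0 → X → E → I₀ → 0` is isomorphic to `I₁`. -/
theorem ext_X_I0 (F : Type) [Field F] [Fintype F] (φ : Polynomial F) (hφ : InSigma1 φ) :
    Ext1IsZero (Rrep φ 1) (Irep F 0) ∧
    ext1Card (Irep F 0) (Rrep φ 1) = Fintype.card F ∧
    (∀ (E : RudRep F) (ι : RudHom (Rrep φ 1) E) (π : RudHom E (Irep F 0)),
      IsSES ι π → ¬ Splits π → RudIso E (Irep F 1)) := by
  obtain ⟨α, β, ⟨P⟩⟩ := exists_kronPoint_Rrep hφ
  have S := simpleAtOneIrep F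
  exact ⟨P.ext1IsZero_simple S, (P.ext1Card_simple S).trans Nat.card_eq_fintype_card,
    fun E ι π h hns => P.rudIso_Irep_one S h hns⟩
end
end

section
/- Let X and Y be finite-dimensional modules over a finite-dimensional algebra over a field, having no isomorphic indecomposable direct summands in common. Then an endomorphism of X ⊕ Y, written in block form [[A, B], [C, D]] with A ∈ End(X), D ∈ End(Y), B ∈ Hom(Y, X), C ∈ Hom(X, Y), is an automorphism if and only if A ∈ Aut(X) and D ∈ Aut(Y). Consequently, over a finite field, |Aut(X ⊕ Y)| = |Aut(X)|·|Aut(Y)|·|Hom(X, Y)|·|Hom(Y, X)|. -/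
open scoped Classical

noncomputable section

/-- A module is indecomposable if it is nonzero and admits no nontrivial decomposition
into complementary submodules. -/
def IndecModule (A : Type) [Ring A] (Z : Type) [AddCommGroup Z] [Module A Z] : Prop :=
  ¬ Subsingleton Z ∧ ∀ U V : Submodule A Z, IsCompl U V → U = ⊥ ∨ V = ⊥

/-- A nonzero direct summand of an Artinian module contains an indecomposable direct summand. -/
theorem exists_le_isComplemented_indecModule {A X : Type} [Ring A] [AddCommGroup X] [Module A X]
    [IsArtinian A X] {U : Submodule A X} (hU : U ≠ ⊥) (hUc : IsComplemented U) :
    ∃ W ≤ U, IsComplemented W ∧ IndecModule A W := by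
  obtain ⟨W, ⟨hW, ⟨W', hWW'⟩, hWU⟩, hmin⟩ := wellFounded_lt.has_min
    {W : Submodule A X | W ≠ ⊥ ∧ IsComplemented W ∧ W ≤ U} ⟨U, hU, hUc, le_rfl⟩
  refine ⟨W, hWU, ⟨W', hWW'⟩, mt Submodule.subsingleton_iff_eq_bot.1 hW, fun P Q hPQ => ?_⟩
  by_contra! hne
  let f : X →ₗ[A] P.map W.subtype :=
    W.subtype.submoduleMap P ∘ₗ P.projectionOnto Q hPQ ∘ₗ W.projectionOnto W' hWW'
  have hf : ∀ x : P.map W.subtype, f x = x := by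
    rintro ⟨_, x, hx, rfl⟩
    have h : P.projectionOnto Q hPQ x = ⟨x, hx⟩ :=
      Submodule.projectionOnto_apply_left hPQ ⟨x, hx⟩
    ext
    simp [f, h]
  refine hmin (P.map W.subtype) ⟨?_, ⟨_, LinearMap.isCompl_of_proj hf⟩,
    (Submodule.map_subtype_le W P).trans hWU⟩ ((Submodule.map_subtype_le W P).lt_of_ne ?_)
  · intro h
    exact hne.1 (Submodule.map_injective_of_injective W.injective_subtype (by simpa using h))
  · intro h
    have hP : P = ⊤ := Submodule.map_injective_of_injective W.injective_subtype (by simpa using h)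
    exact hne.2 (by simpa [hP] using hPQ.disjoint)

/-- If a linear map `c` admits a retraction on a direct summand `W`, then it maps `W`
isomorphically onto a direct summand. -/
theorem isComplemented_map_and_nonempty_equiv {A X Y : Type*} [Ring A] [AddCommGroup X]
    [AddCommGroup Y] [Module A X] [Module A Y] {W : Submodule A X} (hW : IsComplemented W)
    (c : X →ₗ[A] Y) (s : Y →ₗ[A] X) (hs : ∀ w ∈ W, s (c w) = w) :
    IsComplemented (W.map c) ∧ Nonempty (W ≃ₗ[A] W.map c) := by
  obtain ⟨W', hWW'⟩ := hW
  constructor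
  · refine ⟨_, LinearMap.isCompl_of_proj
      (f := c.submoduleMap W ∘ₗ W.projectionOnto W' hWW' ∘ₗ s) ?_⟩
    rintro ⟨_, x, hx, rfl⟩
    have h : W.projectionOnto W' hWW' x = ⟨x, hx⟩ :=
      Submodule.projectionOnto_apply_left hWW' ⟨x, hx⟩
    ext
    simp [hs x hx, h]
  · refine ⟨LinearEquiv.ofBijective (c.submoduleMap W) ⟨fun x y hxy => ?_,
      c.submoduleMap_surjective W⟩⟩
    have h : c x = c y := congrArg Subtype.val hxy
    ext
    rw [← hs x x.2, h, hs y y.2]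

/-- An endomorphism that factors through a module without common indecomposable direct summands
is nilpotent. -/
theorem isNilpotent_comp_of_no_common_summand {A X Y : Type} [Ring A] [AddCommGroup X]
    [AddCommGroup Y] [Module A X] [Module A Y] [IsArtinian A X] [IsNoetherian A X]
    (hcommon : ¬ ∃ (U : Submodule A X) (V : Submodule A Y),
      IsComplemented U ∧ IsComplemented V ∧ IndecModule A U ∧ Nonempty (U ≃ₗ[A] V))
    (b : Y →ₗ[A] X) (c : X →ₗ[A] Y) : IsNilpotent (R := Module.End A X) (b ∘ₗ c) := by
  set f : Module.End A X := b ∘ₗ c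
  obtain ⟨n, hn, hn0⟩ := (f.eventually_isCompl_ker_pow_range_pow.and
    (Filter.eventually_ge_atTop 1)).exists
  refine ⟨n, ?_⟩
  rw [← LinearMap.range_eq_bot]
  by_contra hU
  set U := LinearMap.range (f ^ n)
  let F : U →ₗ[A] U := (f ^ n).restrict fun x _ => LinearMap.mem_range_self (f ^ n) x
  have hF : Function.Injective F := by
    rw [← LinearMap.ker_eq_bot, LinearMap.ker_eq_bot']
    intro x hx
    have h : (f ^ n) x = 0 := congrArg Subtype.val hx
    exact Subtype.ext (Submodule.disjoint_def.1 hn.disjoint x h x.2)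
  let e := LinearEquiv.ofBijective F (IsArtinian.bijective_of_injective_endomorphism F hF)
  let s : Y →ₗ[A] X := U.subtype ∘ₗ e.symm.toLinearMap ∘ₗ
    U.projectionOnto _ hn.symm ∘ₗ b
  have hs : ∀ w ∈ U, s ((c ∘ₗ f ^ (n - 1)) w) = w := by
    intro w hw
    have h1 : b (c ((f ^ (n - 1)) w)) = F ⟨w, hw⟩ := by
      change (f * f ^ (n - 1)) w = (f ^ n) w
      rw [← pow_succ', Nat.sub_add_cancel hn0]
    have h2 : e.symm (F ⟨w, hw⟩) = ⟨w, hw⟩ := e.symm_apply_apply _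
    simp [s, h1, h2]
  obtain ⟨W, hWU, hWc, hWi⟩ := exists_le_isComplemented_indecModule hU ⟨_, hn.symm⟩
  obtain ⟨hV, he⟩ := isComplemented_map_and_nonempty_equiv hWc _ s fun w hw => hs w (hWU hw)
  exact hcommon ⟨W, _, hWc, hV, hWi, he⟩

/-- If every endomorphism of `X` factoring through `Y` is nilpotent, then an endomorphism of
`X × Y` is bijective as soon as its diagonal blocks are. -/
theorem bijective_of_bijective_diagonal {A X Y : Type*} [Ring A] [AddCommGroup X]
    [AddCommGroup Y] [Module A X] [Module A Y] [IsArtinian A X] [IsArtinian A Y]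
    (hnil : ∀ (b : Y →ₗ[A] X) (c : X →ₗ[A] Y), IsNilpotent (R := Module.End A X) (b ∘ₗ c))
    (g : (X × Y) →ₗ[A] (X × Y))
    (hX : Function.Bijective (LinearMap.fst A X Y ∘ₗ g ∘ₗ LinearMap.inl A X Y))
    (hY : Function.Bijective (LinearMap.snd A X Y ∘ₗ g ∘ₗ LinearMap.inr A X Y)) :
    Function.Bijective g := by
  apply IsArtinian.bijective_of_injective_endomorphism
  rw [← LinearMap.ker_eq_bot, LinearMap.ker_eq_bot']
  rintro ⟨x, y⟩ hxy
  let α := LinearEquiv.ofBijective _ hX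
  let δ := LinearEquiv.ofBijective _ hY
  let b := α.symm.toLinearMap ∘ₗ LinearMap.fst A X Y ∘ₗ g ∘ₗ LinearMap.inr A X Y
  let c := δ.symm.toLinearMap ∘ₗ LinearMap.snd A X Y ∘ₗ g ∘ₗ LinearMap.inl A X Y
  have hsum : g (x, 0) + g (0, y) = 0 := by simpa [← map_add] using hxy
  have hα : α x = (g (x, 0)).1 := rfl
  have hδ : δ y = (g (0, y)).2 := rfl
  have hx : x + b y = 0 := by
    apply α.injective
    simpa [b, hα] using congrArg Prod.fst hsum
  have hy : c x + y = 0 := by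
    apply δ.injective
    simpa [c, hδ] using congrArg Prod.snd hsum
  have hyc : y = -c x := eq_neg_of_add_eq_zero_right hy
  have hunit := (hnil b c).isUnit_one_sub
  have hx0 : x = 0 := by
    apply ((Module.End.isUnit_iff _).1 hunit).injective
    rw [map_zero]
    simpa [hyc, sub_eq_add_neg] using hx
  simp [hyc, hx0]

/-- If every endomorphism of `X` factoring through `Y` is nilpotent, then the first diagonal block
of a bijective endomorphism of `X × Y` is bijective. -/
theorem bijective_fst_block_of_bijective {A X Y : Type*} [Ring A] [AddCommGroup X]
    [AddCommGroup Y] [Module A X] [Module A Y] [IsNoetherian A X]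
    (hnil : ∀ (b : Y →ₗ[A] X) (c : X →ₗ[A] Y), IsNilpotent (R := Module.End A X) (b ∘ₗ c))
    (g : (X × Y) →ₗ[A] (X × Y)) (hg : Function.Bijective g) :
    Function.Bijective (LinearMap.fst A X Y ∘ₗ g ∘ₗ LinearMap.inl A X Y) := by
  let h := (LinearEquiv.ofBijective g hg).symm
  let b := LinearMap.fst A X Y ∘ₗ g ∘ₗ LinearMap.inr A X Y
  let c := LinearMap.snd A X Y ∘ₗ h.toLinearMap ∘ₗ LinearMap.inl A X Y
  have hsurj := ((Module.End.isUnit_iff _).1 (hnil b c).isUnit_one_sub).surjective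
  apply IsNoetherian.bijective_of_surjective_endomorphism
  intro x
  obtain ⟨z, rfl⟩ := hsurj x
  refine ⟨(h (z, 0)).1, ?_⟩
  have hgh : g (h (z, 0)) = (z, 0) := (LinearEquiv.ofBijective g hg).apply_symm_apply _
  have hsplit : g ((h (z, 0)).1, 0) + g (0, (h (z, 0)).2) = (z, 0) := by
    rw [← map_add]
    simpa using hgh
  have hfst : (g ((h (z, 0)).1, 0)).1 + (g (0, (h (z, 0)).2)).1 = z := congrArg Prod.fst hsplit
  simpa [b, c] using eq_sub_of_add_eq hfst

/-- If every endomorphism of `Y` factoring through `X` is nilpotent, then the second diagonal block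
of a bijective endomorphism of `X × Y` is bijective. -/
theorem bijective_snd_block_of_bijective {A X Y : Type*} [Ring A] [AddCommGroup X]
    [AddCommGroup Y] [Module A X] [Module A Y] [IsNoetherian A Y]
    (hnil : ∀ (b : X →ₗ[A] Y) (c : Y →ₗ[A] X), IsNilpotent (R := Module.End A Y) (b ∘ₗ c))
    (g : (X × Y) →ₗ[A] (X × Y)) (hg : Function.Bijective g) :
    Function.Bijective (LinearMap.snd A X Y ∘ₗ g ∘ₗ LinearMap.inr A X Y) :=
  let σ := LinearEquiv.prodComm A X Y
  bijective_fst_block_of_bijective hnil (σ.toLinearMap ∘ₗ g ∘ₗ σ.symm.toLinearMap)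
    (σ.bijective.comp (hg.comp σ.symm.bijective))

/-- Linear automorphisms are the bijective endomorphisms. -/
def linearEquivEquivBijective (A M : Type*) [Ring A] [AddCommGroup M] [Module A M] :
    (M ≃ₗ[A] M) ≃ {f : M →ₗ[A] M // Function.Bijective f} where
  toFun e := ⟨e.toLinearMap, e.bijective⟩
  invFun f := LinearEquiv.ofBijective f.1 f.2
  left_inv e := by ext; rfl
  right_inv f := by ext; rfl

/-- Endomorphisms of `X × Y` are matrices of linear maps; the diagonal blocks come first. -/
def endProdEquivBlocks (A X Y : Type*) [Ring A] [AddCommGroup X] [AddCommGroup Y]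
    [Module A X] [Module A Y] :
    ((X × Y) →ₗ[A] (X × Y)) ≃
      ((X →ₗ[A] X) × (Y →ₗ[A] Y)) × ((X →ₗ[A] Y) × (Y →ₗ[A] X)) where
  toFun g := ((LinearMap.fst A X Y ∘ₗ g ∘ₗ LinearMap.inl A X Y,
      LinearMap.snd A X Y ∘ₗ g ∘ₗ LinearMap.inr A X Y),
    (LinearMap.snd A X Y ∘ₗ g ∘ₗ LinearMap.inl A X Y,
      LinearMap.fst A X Y ∘ₗ g ∘ₗ LinearMap.inr A X Y))
  invFun q := (q.1.1.coprod q.2.2).prod (q.2.1.coprod q.1.2)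
  left_inv g := by ext <;> simp [← Prod.zero_eq_mk]
  right_inv q := by ext <;> simp

/-- Let `X`, `Y` be finite-dimensional modules over a finite-dimensional
algebra `A` over a field `k`, with no isomorphic indecomposable direct summand in common.
Then an endomorphism `g` of `X ⊕ Y` is an automorphism iff its diagonal blocks
`fst ∘ g ∘ inl ∈ End(X)` and `snd ∘ g ∘ inr ∈ End(Y)` are automorphisms; consequently,
over a finite field, `|Aut(X ⊕ Y)| = |Aut X| · |Aut Y| · |Hom(X,Y)| · |Hom(Y,X)|`. -/
theorem aut_of_dsum_no_common_summand
    (k : Type) [Field k] (A : Type) [Ring A] [Algebra k A] [FiniteDimensional k A]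
    (X Y : Type) [AddCommGroup X] [AddCommGroup Y] [Module A X] [Module A Y]
    [Module k X] [Module k Y] [IsScalarTower k A X] [IsScalarTower k A Y]
    [FiniteDimensional k X] [FiniteDimensional k Y]
    (hcommon : ¬ ∃ (U : Submodule A X) (V : Submodule A Y),
      (∃ U' : Submodule A X, IsCompl U U') ∧ (∃ V' : Submodule A Y, IsCompl V V') ∧
      IndecModule A ↥U ∧ Nonempty (↥U ≃ₗ[A] ↥V)) :
    (∀ g : (X × Y) →ₗ[A] (X × Y),
      Function.Bijective g ↔
        (Function.Bijective ((LinearMap.fst A X Y) ∘ₗ g ∘ₗ (LinearMap.inl A X Y)) ∧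
         Function.Bijective ((LinearMap.snd A X Y) ∘ₗ g ∘ₗ (LinearMap.inr A X Y)))) ∧
    (Finite k →
      Nat.card ((X × Y) ≃ₗ[A] (X × Y)) =
        Nat.card (X ≃ₗ[A] X) * Nat.card (Y ≃ₗ[A] Y) *
          Nat.card (X →ₗ[A] Y) * Nat.card (Y →ₗ[A] X)) := by
  have := isArtinian_of_tower (S := A) k (inferInstance : IsArtinian k X)
  have := isArtinian_of_tower (S := A) k (inferInstance : IsArtinian k Y)
  have := isNoetherian_of_tower (S := A) k (inferInstance : IsNoetherian k X)
  have := isNoetherian_of_tower (S := A) k (inferInstance : IsNoetherian k Y)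
  have hnilX (b : Y →ₗ[A] X) (c : X →ₗ[A] Y) : IsNilpotent (R := Module.End A X) (b ∘ₗ c) :=
    isNilpotent_comp_of_no_common_summand hcommon b c
  have hnilY (b : X →ₗ[A] Y) (c : Y →ₗ[A] X) : IsNilpotent (R := Module.End A Y) (b ∘ₗ c) := by
    obtain ⟨n, hn⟩ := hnilX c b
    have hpow : ∀ m y, c (((b ∘ₗ c : Module.End A Y) ^ m) y) =
        ((c ∘ₗ b : Module.End A X) ^ m) (c y) := by
      intro m y
      induction m with
      | zero => simp
      | succ m ih => simp [pow_succ', ih]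
    refine ⟨n + 1, LinearMap.ext fun y => ?_⟩
    simp [pow_succ', hpow, hn]
  have hiff : ∀ g : (X × Y) →ₗ[A] (X × Y),
      Function.Bijective g ↔
        (Function.Bijective ((LinearMap.fst A X Y) ∘ₗ g ∘ₗ (LinearMap.inl A X Y)) ∧
         Function.Bijective ((LinearMap.snd A X Y) ∘ₗ g ∘ₗ (LinearMap.inr A X Y))) := fun g =>
    ⟨fun hg => ⟨bijective_fst_block_of_bijective hnilX g hg,
      bijective_snd_block_of_bijective hnilY g hg⟩,
    fun h => bijective_of_bijective_diagonal hnilX g h.1 h.2⟩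
  refine ⟨hiff, fun _ => ?_⟩
  let e : {g : (X × Y) →ₗ[A] (X × Y) // Function.Bijective g} ≃
      {q : ((X →ₗ[A] X) × (Y →ₗ[A] Y)) × ((X →ₗ[A] Y) × (Y →ₗ[A] X)) //
        Function.Bijective q.1.1 ∧ Function.Bijective q.1.2} :=
    (endProdEquivBlocks A X Y).subtypeEquiv hiff
  let e' := Equiv.prodSubtypeFstEquivSubtypeProd (β := (X →ₗ[A] Y) × (Y →ₗ[A] X))
    (p := fun q : (X →ₗ[A] X) × (Y →ₗ[A] Y) => Function.Bijective q.1 ∧ Function.Bijective q.2)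
  let e'' := Equiv.subtypeProdEquivProd
    (p := fun f : X →ₗ[A] X => Function.Bijective f)
    (q := fun f : Y →ₗ[A] Y => Function.Bijective f)
  rw [Nat.card_congr (linearEquivEquivBijective A (X × Y)),
    Nat.card_congr (linearEquivEquivBijective A X), Nat.card_congr (linearEquivEquivBijective A Y),
    Nat.card_congr e, Nat.card_congr e', Nat.card_prod, Nat.card_congr e'', Nat.card_prod,
    Nat.card_prod, mul_assoc, mul_assoc, mul_assoc]
end
end
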